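/- arXiv:2507.08652 — 8 statements merged into one kernel-verified Lean document; each statement's English description precedes it below -/
import Mathlib

section
/- For every ε > 0, the following set of integral binary quartic forms has density 1 when ordered by height: letting F(X) denote the set of forms f(x,y) = f₀x⁴ + f₁x³y + f₂x²y² + f₃xy³ + f₄y⁴ with integer coefficients, nonzero discriminant, and height Ht(f) = maxᵢ|fᵢ| < X, one has lim_{X→∞} #{f ∈ F(X) : for all coprime integers x, y and every rational number z with z² = f(x,y), log max(|x|,|y|) ≥ (5/4 − ε)·log Ht(f)} / #F(X) = 1. -/
open MvPolynomial Filter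

/-- The binary quartic form `f₀x⁴ + f₁x³y + f₂x²y² + f₃xy³ + f₄y⁴` with integer coefficient
tuple `f`, regarded as a polynomial over `ℚ` in the variables `X 0` (for `x`) and
`X 1` (for `y`). -/
noncomputable def quarticForm (f : Fin 5 → ℤ) : MvPolynomial (Fin 2) ℚ :=
  ∑ i : Fin 5, C ((f i : ℚ)) * X 0 ^ (4 - (i : ℕ)) * X 1 ^ (i : ℕ)

/-- The value `f(x,y)` of the quartic form at a pair of integers. -/
def quarticEval (f : Fin 5 → ℤ) (x y : ℤ) : ℤ :=
  ∑ i : Fin 5, f i * x ^ (4 - (i : ℕ)) * y ^ (i : ℕ)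

/-- The height `Ht(f) = maxᵢ |fᵢ|` of an integral binary quartic form. -/
def quarticHt (f : Fin 5 → ℤ) : ℤ :=
  Finset.univ.sup' Finset.univ_nonempty fun i => |f i|

lemma natCast_add_one_le_mul_two_rpow {η : ℝ} (hη : 0 < η) (k : ℕ) :
    (k : ℝ) + 1 ≤ (1 + 1 / (η * Real.log 2)) * (2 : ℝ) ^ ((k : ℝ) * η) := by
  have hl : 0 < η * Real.log 2 := mul_pos hη (Real.log_pos one_lt_two)
  have h1 : 1 + k * (η * Real.log 2) ≤ (2 : ℝ) ^ ((k : ℝ) * η) := by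
    rw [Real.rpow_def_of_pos two_pos]
    have := Real.add_one_le_exp (Real.log 2 * (k * η))
    linarith
  have h2 : (1 + 1 / (η * Real.log 2)) * (1 + k * (η * Real.log 2)) =
      k + 1 + (k * (η * Real.log 2) + 1 / (η * Real.log 2)) := by
    field_simp
    ring
  have h3 : 0 ≤ k * (η * Real.log 2) + 1 / (η * Real.log 2) := by positivity
  calc (k : ℝ) + 1 ≤ (1 + 1 / (η * Real.log 2)) * (1 + k * (η * Real.log 2)) := by linarith
    _ ≤ _ := by gcongr

/-- The divisor bound: `d(n) = O(n ^ η)` for every `η > 0`. -/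
theorem exists_card_divisors_le_mul_rpow {η : ℝ} (hη : 0 < η) :
    ∃ C : ℝ, 0 < C ∧ ∀ n : ℕ, n ≠ 0 → (n.divisors.card : ℝ) ≤ C * (n : ℝ) ^ η := by
  set A : ℝ := 1 + 1 / (η * Real.log 2) with hA
  have hA1 : 1 ≤ A := by
    have : 0 < η * Real.log 2 := mul_pos hη (Real.log_pos one_lt_two)
    have : 0 < 1 / (η * Real.log 2) := by positivity
    linarith
  set B : ℕ := ⌈(2 : ℝ) ^ (1 / η)⌉₊ with hB
  refine ⟨A ^ B, by positivity, fun n hn => ?_⟩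
  have key : ∀ p ∈ n.primeFactors, ((n.factorization p : ℝ) + 1) ≤
      (if p < B then A else 1) * ((p ^ n.factorization p : ℕ) : ℝ) ^ η := by
    intro p hp
    have hp2 : (2 : ℝ) ≤ p := by exact_mod_cast (Nat.prime_of_mem_primeFactors hp).two_le
    have hpow : ((p ^ n.factorization p : ℕ) : ℝ) ^ η =
        (p : ℝ) ^ ((n.factorization p : ℝ) * η) := by
      rw [Nat.cast_pow, ← Real.rpow_natCast, ← Real.rpow_mul (by positivity)]
    rw [hpow]
    split_ifs with h
    · refine (natCast_add_one_le_mul_two_rpow hη _).trans ?_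
      gcongr
    · have hpB : (2 : ℝ) ^ (1 / η) ≤ p := (Nat.le_ceil _).trans (by exact_mod_cast not_lt.1 h)
      have h2 : (2 : ℝ) ≤ (p : ℝ) ^ η := by
        calc (2 : ℝ) = ((2 : ℝ) ^ (1 / η)) ^ η := by
              rw [← Real.rpow_mul (by norm_num), one_div_mul_cancel hη.ne', Real.rpow_one]
          _ ≤ _ := by gcongr
      rw [one_mul, mul_comm, Real.rpow_mul (by positivity), Real.rpow_natCast]
      calc ((n.factorization p : ℝ) + 1) ≤ 2 ^ n.factorization p := by
            exact_mod_cast Nat.lt_two_pow_self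
        _ ≤ _ := by gcongr
  have hprod : ∏ p ∈ n.primeFactors, (if p < B then A else 1) ≤ A ^ B := by
    rw [Finset.prod_ite, Finset.prod_const_one, mul_one, Finset.prod_const]
    refine pow_le_pow_right₀ hA1 ?_
    calc _ ≤ (Finset.range B).card := Finset.card_le_card fun p hp => by
          simpa using (Finset.mem_filter.1 hp).2
      _ = B := Finset.card_range B
  calc (n.divisors.card : ℝ) = ∏ p ∈ n.primeFactors, ((n.factorization p : ℝ) + 1) := by
        rw [Nat.card_divisors hn]; push_cast; rfl
    _ ≤ ∏ p ∈ n.primeFactors, ((if p < B then A else 1) *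
          ((p ^ n.factorization p : ℕ) : ℝ) ^ η) :=
        Finset.prod_le_prod (fun _ _ => by positivity) key
    _ = (∏ p ∈ n.primeFactors, (if p < B then A else 1)) * (n : ℝ) ^ η := by
        rw [Finset.prod_mul_distrib, Real.finsetProd_rpow _ _ (fun _ _ => by positivity),
          ← Nat.cast_prod]
        congr 3
        exact Nat.prod_factorization_pow_eq_self hn
    _ ≤ _ := by gcongr

/-- A set of integers in an interval of length `L`, all congruent modulo `d`, has at most
`L / d + 1` elements. -/
lemma card_le_div_add_one_of_dvd_sub {s : Finset ℤ} {a : ℤ} {L d : ℕ} (hd : 0 < d)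
    (hs : s ⊆ Finset.Icc a (a + L)) (h : ∀ z ∈ s, ∀ w ∈ s, (d : ℤ) ∣ z - w) :
    s.card ≤ L / d + 1 := by
  have hd' : (0 : ℤ) < d := by exact_mod_cast hd
  rw [← Finset.card_range (L / d + 1)]
  refine Finset.card_le_card_of_injOn (fun z => ((z - a) / d).toNat) ?_ ?_
  · intro z hz
    have := Finset.mem_Icc.1 (hs hz)
    have h1 : (z - a) / d ≤ (L : ℤ) / d := Int.ediv_le_ediv hd' (by linarith)
    have h2 : 0 ≤ (z - a) / d := Int.ediv_nonneg (by linarith) hd'.le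
    simp only [Finset.coe_range, Set.mem_Iio]
    zify
    rw [Int.toNat_of_nonneg h2]
    linarith
  · intro z hz w hw hzw
    have hz' := Finset.mem_Icc.1 (hs hz)
    have hw' := Finset.mem_Icc.1 (hs hw)
    have h1 : 0 ≤ (z - a) / d := Int.ediv_nonneg (by linarith) hd'.le
    have h2 : 0 ≤ (w - a) / d := Int.ediv_nonneg (by linarith) hd'.le
    have h3 : (z - a) / d = (w - a) / d := by
      simp only at hzw
      omega
    have h4 : (z - a) % d = (w - a) % d := by
      refine (Int.modEq_iff_dvd.2 ?_ : w - a ≡ z - a [ZMOD d]).symm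
      rw [sub_sub_sub_cancel_right]
      exact h z hz w hw
    have h5 := Int.emod_add_mul_ediv (z - a) d
    have h6 := Int.emod_add_mul_ediv (w - a) d
    rw [h3, h4] at h5
    linarith

/-- The number of square roots of `a x⁴ + b x³ y` modulo `y²` in an interval of length `S y²`. -/
lemma card_sqrt_mod_sq_le {x a b : ℤ} {y : ℕ} (S : ℕ) (hy : 0 < y) (ha : a ≠ 0)
    (hxy : IsCoprime x (y : ℤ)) :
    ((Finset.Icc (0 : ℤ) (S * y ^ 2 : ℕ)).filter
      (fun z => ((y : ℤ) ^ 2) ∣ z ^ 2 - (a * x ^ 4 + b * x ^ 3 * y))).card ≤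
      (2 * (Int.gcd y a * S) + 1) * (y ^ 2).divisors.card := by
  set R := (Finset.Icc (0 : ℤ) (S * y ^ 2 : ℕ)).filter
      (fun z => ((y : ℤ) ^ 2) ∣ z ^ 2 - (a * x ^ 4 + b * x ^ 3 * y)) with hR
  have hy2 : y ^ 2 ≠ 0 := by positivity
  rcases R.eq_empty_or_nonempty with h0 | ⟨w, hw⟩
  · simp [h0]
  have hwd := (Finset.mem_filter.1 hw).2
  refine Finset.card_le_mul_card_image_of_maps_to
    (f := fun z : ℤ => Int.gcd (z - w) ((y ^ 2 : ℕ) : ℤ)) ?_ _ ?_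
  · intro z _
    refine Nat.mem_divisors.2 ⟨?_, hy2⟩
    have := Int.gcd_dvd_right (z - w) ((y ^ 2 : ℕ) : ℤ)
    exact_mod_cast this
  intro m hm
  obtain ⟨k, hk⟩ := Nat.dvd_of_mem_divisors hm
  have hmpos : 0 < m := Nat.pos_of_mem_divisors hm
  have hkpos : 0 < k := Nat.pos_of_ne_zero fun h => hy2 (by rw [hk, h, mul_zero])
  set T := R.filter (fun z : ℤ => Int.gcd (z - w) ((y ^ 2 : ℕ) : ℤ) = m) with hT
  have hminus : ∀ z ∈ T, (m : ℤ) ∣ z - w := by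
    intro z hz
    rw [← (Finset.mem_filter.1 hz).2]
    exact Int.gcd_dvd_left _ _
  have hplus : ∀ z ∈ T, (k : ℤ) ∣ z + w := by
    intro z hz
    have hzd := (Finset.mem_filter.1 (Finset.mem_filter.1 hz).1).2
    have hg := (Finset.mem_filter.1 hz).2
    have hd : (m : ℤ) * k ∣ (z - w) * (z + w) := by
      have := dvd_sub hzd hwd
      rw [show (m : ℤ) * k = (y : ℤ) ^ 2 by exact_mod_cast hk.symm]
      rwa [show (z - w) * (z + w) = z ^ 2 - (a * x ^ 4 + b * x ^ 3 * y) -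
        (w ^ 2 - (a * x ^ 4 + b * x ^ 3 * y)) by ring]
    obtain ⟨u, hu⟩ := hminus z hz
    rw [hu, mul_assoc] at hd
    have hd' := Int.dvd_of_mul_dvd_mul_left (by exact_mod_cast hmpos.ne') hd
    refine Int.dvd_of_dvd_mul_right_of_gcd_one hd' ?_
    rw [hu, hk, Nat.cast_mul, Int.gcd_mul_left, Int.natAbs_natCast] at hg
    rw [Int.gcd_comm]
    exact Nat.eq_of_mul_eq_mul_left hmpos (by rw [hg, mul_one])
  rcases T.eq_empty_or_nonempty with h0 | ⟨z, hz⟩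
  · simp [h0]
  have hlcm : 0 < Nat.lcm m k := Nat.lcm_pos hmpos hkpos
  have hcard : T.card ≤ (S * y ^ 2) / Nat.lcm m k + 1 := by
    refine card_le_div_add_one_of_dvd_sub (a := 0) hlcm ?_ ?_
    · rw [zero_add]
      exact (Finset.filter_subset _ _).trans (Finset.filter_subset _ _)
    · intro u hu v hv
      have h1 : (m : ℤ) ∣ u - v := by simpa using dvd_sub (hminus u hu) (hminus v hv)
      have h2 : (k : ℤ) ∣ u - v := by simpa using dvd_sub (hplus u hu) (hplus v hv)
      have := Int.coe_lcm_dvd h1 h2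
      simpa [Int.lcm] using this
  refine hcard.trans (Nat.succ_le_succ ?_)
  set e := Nat.gcd m k with he
  have hem : (e : ℤ) ∣ m := by exact_mod_cast Nat.gcd_dvd_left m k
  have hek : (e : ℤ) ∣ k := by exact_mod_cast Nat.gcd_dvd_right m k
  have hey : (e : ℤ) ∣ y := by
    have : e ^ 2 ∣ y ^ 2 := by
      rw [hk, sq]
      exact mul_dvd_mul (Nat.gcd_dvd_left m k) (Nat.gcd_dvd_right m k)
    exact_mod_cast (Nat.pow_dvd_pow_iff two_ne_zero).1 this
  have hew : (e : ℤ) ∣ 2 * w := by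
    have := dvd_sub (hek.trans (hplus z hz)) (hem.trans (hminus z hz))
    rwa [show 2 * w = z + w - (z - w) by ring]
  have hh : ((Int.gcd w y : ℕ) : ℤ) ∣ a := by
    have h1 : ((Int.gcd w y : ℕ) : ℤ) ∣ w := Int.gcd_dvd_left _ _
    have h2 : ((Int.gcd w y : ℕ) : ℤ) ∣ y := Int.gcd_dvd_right _ _
    have h3 : ((Int.gcd w y : ℕ) : ℤ) ∣ a * x ^ 4 := by
      have h4 := (h2.trans (dvd_pow_self (y : ℤ) two_ne_zero)).trans hwd
      have h5 := dvd_sub (dvd_sub (h1.trans (dvd_pow_self w two_ne_zero)) h4)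
        (h2.mul_left (b * x ^ 3))
      rwa [show a * x ^ 4 = w ^ 2 - (w ^ 2 - (a * x ^ 4 + b * x ^ 3 * y)) - b * x ^ 3 * y by ring]
    refine IsCoprime.dvd_of_dvd_mul_right (IsCoprime.pow_right ?_) h3
    exact (hxy.of_isCoprime_of_dvd_right h2).symm
  have heg : e ∣ 2 * Int.gcd y a := by
    have h1 : e ∣ 2 * Int.gcd w y := by
      have : e ∣ Int.gcd (2 * w) (2 * y) := Int.dvd_gcd hew (hey.mul_left 2)
      simpa [Int.gcd_mul_left] using this
    refine h1.trans (mul_dvd_mul_left 2 ?_)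
    exact Int.dvd_gcd (Int.gcd_dvd_right _ _) hh
  have hele : e ≤ 2 * Int.gcd y a := Nat.le_of_dvd
    (by have := Int.gcd_pos_of_ne_zero_right (y : ℤ) ha; omega) heg
  have hprod : y ^ 2 = e * Nat.lcm m k := by rw [hk, Nat.gcd_mul_lcm]
  rw [hprod, show S * (e * Nat.lcm m k) = (S * e) * Nat.lcm m k by ring,
    Nat.mul_div_cancel _ hlcm]
  calc S * e ≤ S * (2 * Int.gcd y a) := Nat.mul_le_mul_left _ hele
    _ = _ := by ring

lemma quarticEval_eq (f : Fin 5 → ℤ) (x y : ℤ) :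
    quarticEval f x y =
      f 0 * x ^ 4 + f 1 * x ^ 3 * y + f 2 * x ^ 2 * y ^ 2 + f 3 * x * y ^ 3 + f 4 * y ^ 4 := by
  simp [quarticEval, Fin.sum_univ_five]

/-- The integral coefficient tuples all of whose entries are at most `N` in absolute value. -/
noncomputable def coeffBox (N : ℕ) : Finset (Fin 5 → ℤ) := Fintype.piFinset fun _ => Finset.Icc (-(N : ℤ)) N

lemma mem_coeffBox {N : ℕ} {f : Fin 5 → ℤ} : f ∈ coeffBox N ↔ ∀ i, |f i| ≤ N := by
  simp [coeffBox, abs_le]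

lemma card_coeffBox (N : ℕ) : (coeffBox N).card = (2 * N + 1) ^ 5 := by
  have : ((N : ℤ) + 1 + N).toNat = 2 * N + 1 := by omega
  simp [coeffBox, this]

/-- Forms in the box with prescribed `f₀, f₁` and prescribed value at `(x, y)`. -/
lemma card_le_of_prescribed_value {N y : ℕ} {x : ℤ} (hy : 0 < y) (hxy : IsCoprime x (y : ℤ))
    {U : Finset (Fin 5 → ℤ)} (hU : U ⊆ coeffBox N)
    (h : ∀ f ∈ U, ∀ g ∈ U, f 0 = g 0 ∧ f 1 = g 1 ∧ quarticEval f x y = quarticEval g x y) :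
    U.card ≤ (2 * N / y + 1) ^ 2 := by
  have hy' : (y : ℤ) ≠ 0 := by exact_mod_cast hy.ne'
  have hbox : ∀ i, ∀ V ⊆ U, V.image (fun f => f i) ⊆
      Finset.Icc (-(N : ℤ)) (-N + (2 * N : ℕ)) := by
    intro i V hV z hz
    obtain ⟨f, hf, rfl⟩ := Finset.mem_image.1 hz
    have := abs_le.1 (mem_coeffBox.1 (hU (hV hf)) i)
    rw [Finset.mem_Icc]
    push_cast
    constructor <;> linarith
  have hrel : ∀ f ∈ U, ∀ g ∈ U, (f 2 - g 2) * x ^ 2 + (f 3 - g 3) * x * y +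
      (f 4 - g 4) * (y : ℤ) ^ 2 = 0 := by
    intro f hf g hg
    obtain ⟨h0, h1, h2⟩ := h f hf g hg
    rw [quarticEval_eq, quarticEval_eq, h0, h1] at h2
    refine (mul_eq_zero.1 (?_ : (y : ℤ) ^ 2 * _ = 0)).resolve_left (pow_ne_zero 2 hy')
    linear_combination h2
  rw [sq]
  refine (Finset.card_le_mul_card_image (f := fun f => f 2) U (2 * N / y + 1) ?_).trans
    (Nat.mul_le_mul_left _ ?_)
  · intro c _
    set V := U.filter (fun f => f 2 = c) with hV
    have hVU : V ⊆ U := Finset.filter_subset _ _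
    have hrel' : ∀ f ∈ V, ∀ g ∈ V, (f 3 - g 3) * x + (f 4 - g 4) * (y : ℤ) = 0 := by
      intro f hf g hg
      have := hrel f (hVU hf) g (hVU hg)
      rw [(Finset.mem_filter.1 hf).2, (Finset.mem_filter.1 hg).2] at this
      refine (mul_eq_zero.1 (?_ : (y : ℤ) * _ = 0)).resolve_left hy'
      linear_combination this
    rw [← Finset.card_image_of_injOn (f := fun f : Fin 5 → ℤ => f 3) (s := V)]
    · refine card_le_div_add_one_of_dvd_sub hy (hbox 3 V hVU) ?_
      intro z hz w hw
      obtain ⟨f, hf, rfl⟩ := Finset.mem_image.1 hz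
      obtain ⟨g, hg, rfl⟩ := Finset.mem_image.1 hw
      refine hxy.symm.dvd_of_dvd_mul_right ⟨-(f 4 - g 4), ?_⟩
      linear_combination hrel' f hf g hg
    · intro f hf g hg hfg
      have h3 : f 3 = g 3 := hfg
      have h4 := hrel' f hf g hg
      rw [h3, sub_self, zero_mul, zero_add] at h4
      have h4' := sub_eq_zero.1 ((mul_eq_zero.1 h4).resolve_right hy')
      obtain ⟨h0, h1, -⟩ := h f (hVU hf) g (hVU hg)
      have h2 : f 2 = g 2 := by rw [(Finset.mem_filter.1 hf).2, (Finset.mem_filter.1 hg).2]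
      funext i
      fin_cases i <;> assumption
  · refine card_le_div_add_one_of_dvd_sub hy (hbox 2 U subset_rfl) ?_
    intro z hz w hw
    obtain ⟨f, hf, rfl⟩ := Finset.mem_image.1 hz
    obtain ⟨g, hg, rfl⟩ := Finset.mem_image.1 hw
    refine (IsCoprime.pow_right (n := 2) hxy.symm).dvd_of_dvd_mul_right
      ⟨-((f 3 - g 3) * x + (f 4 - g 4) * y), ?_⟩
    linear_combination hrel f hf g hg

lemma sum_gcd_le {N y : ℕ} (hy : 0 < y) :
    ∑ a ∈ (Finset.Icc (-(N : ℤ)) N).erase 0, Int.gcd y a ≤ 3 * N * y.divisors.card := by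
  set A := (Finset.Icc (-(N : ℤ)) N).erase 0 with hA
  have hle : ∀ a ∈ A, Int.gcd y a ≤ ∑ g ∈ y.divisors, if (g : ℤ) ∣ a then g else 0 := by
    intro a _
    have hm : Int.gcd y a ∈ y.divisors :=
      Nat.mem_divisors.2 ⟨by exact_mod_cast Int.gcd_dvd_left (y : ℤ) a, hy.ne'⟩
    refine le_trans (le_of_eq ?_) (Finset.single_le_sum
      (f := fun g : ℕ => if (g : ℤ) ∣ a then g else 0) (fun _ _ => Nat.zero_le _) hm)
    simp [Int.gcd_dvd_right]
  calc _ ≤ ∑ a ∈ A, ∑ g ∈ y.divisors, (if (g : ℤ) ∣ a then g else 0) := Finset.sum_le_sum hle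
    _ = ∑ g ∈ y.divisors, (A.filter (fun a => (g : ℤ) ∣ a)).card * g := by
        rw [Finset.sum_comm]
        refine Finset.sum_congr rfl fun g _ => ?_
        rw [← Finset.sum_filter, Finset.sum_const, smul_eq_mul]
    _ ≤ ∑ g ∈ y.divisors, 3 * N := by
        refine Finset.sum_le_sum fun g hg => ?_
        have hgpos : 0 < g := Nat.pos_of_mem_divisors hg
        rcases lt_or_ge N g with hlt | hge
        · rw [Finset.filter_eq_empty_iff.2]
          · simp
          · intro a ha hdvd
            obtain ⟨h0, h1⟩ := Finset.mem_erase.1 ha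
            have h2 := abs_le.2 (Finset.mem_Icc.1 h1)
            have h3 := Int.le_of_dvd (abs_pos.2 h0) ((dvd_abs _ _).2 hdvd)
            have : (N : ℤ) < g := by exact_mod_cast hlt
            linarith
        · have := card_le_div_add_one_of_dvd_sub (s := A.filter (fun a => (g : ℤ) ∣ a))
            (a := -N) (L := 2 * N) hgpos ?_ ?_
          · calc _ ≤ (2 * N / g + 1) * g := Nat.mul_le_mul_right _ this
              _ = 2 * N / g * g + g := by ring
              _ ≤ 2 * N + g := Nat.add_le_add_right (Nat.div_mul_le_self _ _) _
              _ ≤ 3 * N := by omega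
          · intro a ha
            have := Finset.mem_Icc.1 (Finset.mem_of_mem_erase (Finset.mem_filter.1 ha).1)
            rw [Finset.mem_Icc]
            push_cast
            constructor <;> linarith
          · intro z hz w hw
            exact dvd_sub (Finset.mem_filter.1 hz).2 (Finset.mem_filter.1 hw).2
    _ = _ := by rw [Finset.sum_const, smul_eq_mul, mul_comm]

open Classical in
/-- The number of forms in the box with `f₀ ≠ 0` taking a square value at a given primitive
point `(x, y)` with `|x| ≤ y`. -/
lemma card_isSquare_eval_le {N y S : ℕ} {x : ℤ} (hN : 0 < N) (hS : 5 * N ≤ S ^ 2) (hy : 0 < y)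
    (hx : |x| ≤ y) (hxy : IsCoprime x (y : ℤ)) :
    ((coeffBox N).filter fun f => f 0 ≠ 0 ∧ IsSquare (quarticEval f x y)).card ≤
      (2 * N / y + 1) ^ 2 * (24 * N ^ 2 * S * (y ^ 2).divisors.card ^ 2) := by
  set U := (coeffBox N).filter fun f => f 0 ≠ 0 ∧ IsSquare (quarticEval f x y) with hU
  set D := (y ^ 2).divisors.card with hD
  have hS1 : 1 ≤ S := by
    rcases Nat.eq_zero_or_pos S with h | h
    · subst h; omega
    · exact h
  have hD1 : 1 ≤ D := Finset.card_pos.2 (Nat.nonempty_divisors.2 (by positivity))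
  set A := (Finset.Icc (-(N : ℤ)) N).erase 0 with hA
  set B := Finset.Icc (-(N : ℤ)) N with hB
  set P : Finset (Σ _ : ℤ × ℤ, ℤ) := (A ×ˢ B).sigma fun p =>
    (Finset.Icc (0 : ℤ) (S * y ^ 2 : ℕ)).filter
      (fun z => ((y : ℤ) ^ 2) ∣ z ^ 2 - (p.1 * x ^ 4 + p.2 * x ^ 3 * y)) with hP
  have hAcard : A.card = 2 * N := by
    have h0 : (0 : ℤ) ∈ B := by simp [hB]
    rw [hA, Finset.card_erase_of_mem h0, Int.card_Icc]
    omega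
  have hBcard : B.card = 2 * N + 1 := by
    rw [hB, Int.card_Icc]
    omega
  have hPcard : P.card ≤ 24 * N ^ 2 * S * D ^ 2 := by
    have hyD : y.divisors.card ≤ D :=
      Finset.card_le_card (Nat.divisors_subset_of_dvd (by positivity) (dvd_pow_self y two_ne_zero))
    calc P.card = ∑ p ∈ A ×ˢ B, _ := Finset.card_sigma _ _
      _ ≤ ∑ p ∈ A ×ˢ B, (2 * (Int.gcd y p.1 * S) + 1) * D := by
          refine Finset.sum_le_sum fun p hp => ?_
          exact card_sqrt_mod_sq_le S hy
            (Finset.ne_of_mem_erase (Finset.mem_product.1 hp).1) hxy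
      _ = (2 * N + 1) * D * (2 * S * ∑ a ∈ A, Int.gcd y a + 2 * N) := by
          rw [Finset.sum_product]
          simp only [Finset.sum_const, smul_eq_mul, hBcard]
          rw [← Finset.mul_sum, ← Finset.sum_mul, Finset.sum_add_distrib, Finset.sum_const,
            smul_eq_mul, hAcard, ← Finset.mul_sum, ← Finset.sum_mul]
          ring
      _ ≤ (2 * N + N) * D * (2 * S * (3 * N * D) + 2 * N * (S * D)) := by
          refine Nat.mul_le_mul (Nat.mul_le_mul_right _ (by omega)) (Nat.add_le_add
            (Nat.mul_le_mul_left _ ((sum_gcd_le hy).trans (by gcongr)))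
            (Nat.le_mul_of_pos_right _ (Nat.mul_pos hS1 hD1)))
      _ = _ := by ring
  set F : (Fin 5 → ℤ) → (Σ _ : ℤ × ℤ, ℤ) := fun f =>
    ⟨(f 0, f 1), Int.sqrt (quarticEval f x y)⟩ with hF
  have hsq : ∀ f ∈ U, Int.sqrt (quarticEval f x y) ^ 2 = quarticEval f x y := by
    intro f hf
    obtain ⟨z, hz⟩ := (Finset.mem_filter.1 hf).2.2
    rw [hz, Int.sqrt_eq, Int.natAbs_sq, sq]
  have himage : U.image F ⊆ P := by
    intro p hp
    obtain ⟨f, hf, rfl⟩ := Finset.mem_image.1 hp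
    obtain ⟨hbox, h0, -⟩ := Finset.mem_filter.1 hf
    have hc := mem_coeffBox.1 hbox
    have hv := hsq f hf
    have hc' : ∀ i, f i ∈ B := fun i => Finset.mem_Icc.2 (abs_le.1 (hc i))
    refine Finset.mem_sigma.2 ⟨Finset.mem_product.2
      ⟨Finset.mem_erase.2 ⟨h0, hc' 0⟩, hc' 1⟩, Finset.mem_filter.2 ⟨Finset.mem_Icc.2
        ⟨Int.sqrt_nonneg _, ?_⟩, ?_⟩⟩
    · have hbound : quarticEval f x y ≤ 5 * N * (y : ℤ) ^ 4 := by
        rw [quarticEval]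
        calc _ ≤ ∑ _i : Fin 5, (N : ℤ) * (y : ℤ) ^ 4 := by
              refine Finset.sum_le_sum fun i _ => (le_abs_self _).trans ?_
              rw [abs_mul, abs_mul, abs_pow, abs_pow, Nat.abs_cast]
              calc _ ≤ (N : ℤ) * (y : ℤ) ^ (4 - (i : ℕ)) * (y : ℤ) ^ (i : ℕ) := by
                    gcongr
                    exact hc i
                _ = _ := by
                    rw [mul_assoc, ← pow_add, Nat.sub_add_cancel (by omega)]
          _ = _ := by
              simp
              ring
      have hS' : (5 * N : ℤ) ≤ (S : ℤ) ^ 2 := by exact_mod_cast hS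
      refine le_of_sq_le_sq ?_ (by positivity)
      rw [hv]
      push_cast
      calc _ ≤ 5 * N * (y : ℤ) ^ 4 := hbound
        _ ≤ (S : ℤ) ^ 2 * (y : ℤ) ^ 4 := by gcongr
        _ = _ := by ring
    · simp only [hF]
      rw [hv, quarticEval_eq]
      exact ⟨f 2 * x ^ 2 + f 3 * x * y + f 4 * y ^ 2, by ring⟩
  refine (Finset.card_le_mul_card_image (f := F) U ((2 * N / y + 1) ^ 2) ?_).trans
    (Nat.mul_le_mul_left _ ((Finset.card_le_card himage).trans hPcard))
  intro p _
  refine card_le_of_prescribed_value hy hxy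
    ((Finset.filter_subset _ _).trans (Finset.filter_subset _ _)) ?_
  intro f hf g hg
  have hfg : F f = F g := by rw [(Finset.mem_filter.1 hf).2, (Finset.mem_filter.1 hg).2]
  simp only [hF, Sigma.mk.injEq, Prod.mk.injEq, heq_eq_eq] at hfg
  refine ⟨hfg.1.1, hfg.1.2, ?_⟩
  rw [← hsq f (Finset.mem_filter.1 hf).1, ← hsq g (Finset.mem_filter.1 hg).1, hfg.2]

/-- A set of forms in the box meeting each line parallel to the `i`-th axis in at most `k`
points has at most `k (2N + 1)⁴` elements. -/
lemma card_le_of_card_line_le {N k : ℕ} (i : Fin 5) {U : Finset (Fin 5 → ℤ)}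
    (hU : U ⊆ coeffBox N)
    (h : ∀ V ⊆ U, (∀ f ∈ V, ∀ g ∈ V, ∀ j ≠ i, f j = g j) → V.card ≤ k) :
    U.card ≤ k * (2 * N + 1) ^ 4 := by
  have hmaps : ∀ f ∈ U, (fun j => f (i.succAbove j)) ∈
      Fintype.piFinset fun _ : Fin 4 => Finset.Icc (-(N : ℤ)) N := by
    intro f hf
    exact Fintype.mem_piFinset.2 fun j =>
      Finset.mem_Icc.2 (abs_le.1 (mem_coeffBox.1 (hU hf) _))
  have hN : ((N : ℤ) + 1 + N).toNat = 2 * N + 1 := by omega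
  refine (Finset.card_le_mul_card_image_of_maps_to hmaps k ?_).trans (le_of_eq ?_)
  · intro c _
    refine h _ (Finset.filter_subset _ _) fun f hf g hg j hj => ?_
    obtain ⟨l, rfl⟩ := Fin.exists_succAbove_eq hj
    have hfc := congrFun (Finset.mem_filter.1 hf).2 l
    have hgc := congrFun (Finset.mem_filter.1 hg).2 l
    exact hfc.trans hgc.symm
  · simp [hN]

lemma card_coeff_eq_zero_le (N : ℕ) (i : Fin 5) :
    ((coeffBox N).filter fun f => f i = 0).card ≤ (2 * N + 1) ^ 4 := by
  rw [← one_mul ((2 * N + 1) ^ 4)]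
  refine card_le_of_card_line_le i (Finset.filter_subset _ _) fun V hV h => ?_
  refine Finset.card_le_one.2 fun f hf g hg => funext fun j => ?_
  by_cases hj : j = i
  · rw [hj, (Finset.mem_filter.1 (hV hf)).2, (Finset.mem_filter.1 (hV hg)).2]
  · exact h f hf g hg j hj

/-- A quartic form with `f₀ ≠ 0` that is not squarefree has a multiple root in `ℂ`. -/
lemma exists_multiple_root_of_not_squarefree {f : Fin 5 → ℤ} (h0 : f 0 ≠ 0)
    (hf : ¬ Squarefree (quarticForm f)) :
    ∃ α : ℂ, f 0 * α ^ 4 + f 1 * α ^ 3 + f 2 * α ^ 2 + f 3 * α + f 4 = 0 ∧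
      4 * f 0 * α ^ 3 + 3 * f 1 * α ^ 2 + 2 * f 2 * α + f 3 = 0 := by
  rw [Squarefree] at hf
  push Not at hf
  obtain ⟨g, ⟨q, hq⟩, hg⟩ := hf
  set Φ := finSuccEquiv ℚ 1 with hΦ
  have hΦf : Φ (quarticForm f) =
      Polynomial.C (C (f 0 : ℚ)) * Polynomial.X ^ 4 +
      Polynomial.C (C (f 1 : ℚ) * X 0) * Polynomial.X ^ 3 +
      Polynomial.C (C (f 2 : ℚ) * X 0 ^ 2) * Polynomial.X ^ 2 +
      Polynomial.C (C (f 3 : ℚ) * X 0 ^ 3) * Polynomial.X +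
      Polynomial.C (C (f 4 : ℚ) * X 0 ^ 4) := by
    have hX1 : Φ (X 1) = Polynomial.C (X 0) := finSuccEquiv_X_succ (n := 1) (j := 0)
    have hC : ∀ a : ℚ, Φ (C a) = Polynomial.C (C a) := (finSuccEquiv ℚ 1).commutes
    have hX0 : Φ (X 0) = Polynomial.X := finSuccEquiv_X_zero
    simp only [quarticForm, Fin.sum_univ_five, map_add, map_mul, map_pow, hX1, hX0, hC]
    simp
    ring
  have h0' : (C (f 0 : ℚ) : MvPolynomial (Fin 1) ℚ) ≠ 0 := by
    rw [Ne, C_eq_zero]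
    exact_mod_cast h0
  have hlead : (Φ (quarticForm f)).leadingCoeff = C (f 0 : ℚ) := by
    have hdeg : (Φ (quarticForm f)).natDegree = 4 := by
      rw [hΦf]
      compute_degree!
    rw [Polynomial.leadingCoeff, hdeg, hΦf]
    simp only [Polynomial.coeff_add, Polynomial.coeff_C_mul, Polynomial.coeff_X_pow,
      Polynomial.coeff_X, Polynomial.coeff_C]
    norm_num
  have hmul : Φ (quarticForm f) = Φ g * Φ g * Φ q := by rw [hq, map_mul, map_mul]
  have hunit : IsUnit (Φ g).leadingCoeff := by
    have : IsUnit (C (f 0 : ℚ) : MvPolynomial (Fin 1) ℚ) :=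
      (IsUnit.mk0 _ (by exact_mod_cast h0)).map C
    rw [← hlead, hmul, Polynomial.leadingCoeff_mul, Polynomial.leadingCoeff_mul] at this
    exact isUnit_of_mul_isUnit_left (isUnit_of_mul_isUnit_left this)
  have hdeg : (Φ g).natDegree ≠ 0 := by
    intro h
    refine hg ((MulEquiv.isUnit_map Φ).1 ?_)
    rw [Polynomial.eq_C_of_natDegree_eq_zero h]
    rw [Polynomial.leadingCoeff, h] at hunit
    exact hunit.map Polynomial.C
  set φ : MvPolynomial (Fin 1) ℚ →+* ℂ := eval₂Hom (algebraMap ℚ ℂ) fun _ => 1 with hφ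
  have hdeg' : ((Φ g).map φ).degree ≠ 0 := by
    intro h
    refine hdeg ?_
    rw [← Polynomial.natDegree_map_of_leadingCoeff_ne_zero φ (hunit.map φ).ne_zero]
    exact Polynomial.natDegree_eq_of_degree_eq_some h
  obtain ⟨α, hα⟩ := IsAlgClosed.exists_root _ hdeg'
  set P : Polynomial ℂ := (Φ (quarticForm f)).map φ with hP
  have hPval : P = Polynomial.C (f 0 : ℂ) * Polynomial.X ^ 4 +
      Polynomial.C (f 1 : ℂ) * Polynomial.X ^ 3 + Polynomial.C (f 2 : ℂ) * Polynomial.X ^ 2 +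
      Polynomial.C (f 3 : ℂ) * Polynomial.X + Polynomial.C (f 4 : ℂ) := by
    rw [hP, hΦf]
    simp [hφ]
  have hPmul : P = (Φ g).map φ * (Φ g).map φ * (Φ q).map φ := by
    rw [hP, hmul, Polynomial.map_mul, Polynomial.map_mul]
  have hα' : ((Φ g).map φ).eval α = 0 := hα
  refine ⟨α, ?_, ?_⟩
  · have h1 : P.eval α = 0 := by rw [hPmul]; simp only [Polynomial.eval_mul, hα', zero_mul]
    rw [hPval] at h1
    simpa using h1
  · have h1 : P.derivative.eval α = 0 := by
      rw [hPmul]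
      simp only [Polynomial.derivative_mul, Polynomial.eval_mul, Polynomial.eval_add, hα']
      ring
    rw [hPval] at h1
    simp at h1
    linear_combination h1

open Classical in
lemma card_not_squarefree_le (N : ℕ) :
    ((coeffBox N).filter fun f => f 0 ≠ 0 ∧ ¬ Squarefree (quarticForm f)).card ≤
      3 * (2 * N + 1) ^ 4 := by
  refine card_le_of_card_line_le 4 (Finset.filter_subset _ _) fun V hV h => ?_
  rcases V.eq_empty_or_nonempty with rfl | ⟨g, hg⟩
  · simp
  have hg0 : (g 0 : ℂ) ≠ 0 := by
    exact_mod_cast (Finset.mem_filter.1 (hV hg)).2.1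
  set Q : Polynomial ℂ := Polynomial.C (4 * g 0 : ℂ) * Polynomial.X ^ 3 +
    Polynomial.C (3 * g 1 : ℂ) * Polynomial.X ^ 2 + Polynomial.C (2 * g 2 : ℂ) * Polynomial.X +
    Polynomial.C (g 3 : ℂ) with hQ
  have hQdeg : Q.natDegree = 3 := Polynomial.natDegree_cubic (by simpa using hg0)
  have hQ0 : Q ≠ 0 := by
    intro h0
    rw [h0] at hQdeg
    simp at hQdeg
  set e : ℂ → ℂ := fun α => -(g 0 * α ^ 4 + g 1 * α ^ 3 + g 2 * α ^ 2 + g 3 * α) with he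
  calc V.card = (V.image fun f : Fin 5 → ℤ => (f 4 : ℂ)).card := by
        refine (Finset.card_image_of_injOn fun f hf f' hf' hff => ?_).symm
        funext j
        by_cases hj : j = 4
        · subst hj
          exact_mod_cast hff
        · exact h f hf f' hf' j hj
    _ ≤ (Q.roots.toFinset.image e).card := by
        refine Finset.card_le_card fun c hc => ?_
        obtain ⟨f, hf, rfl⟩ := Finset.mem_image.1 hc
        obtain ⟨-, hf0, hfs⟩ := Finset.mem_filter.1 (hV hf)
        obtain ⟨α, h1, h2⟩ := exists_multiple_root_of_not_squarefree hf0 hfs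
        rw [h f hf g hg 0 (by decide), h f hf g hg 1 (by decide), h f hf g hg 2 (by decide),
          h f hf g hg 3 (by decide)] at h1 h2
        refine Finset.mem_image.2 ⟨α, ?_, ?_⟩
        · rw [Multiset.mem_toFinset, Polynomial.mem_roots hQ0, Polynomial.IsRoot, hQ]
          simpa using h2
        · rw [he]
          linear_combination -h1
    _ ≤ Q.roots.toFinset.card := Finset.card_image_le
    _ ≤ Q.roots.card := Multiset.toFinset_card_le _
    _ ≤ 3 := hQdeg ▸ Q.card_roots'

/-- The form `f` takes a square value at some primitive point `(x, y)` with
`|x| ≤ y ≤ M`. -/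
def HasSmallSquareValue (M : ℕ) (f : Fin 5 → ℤ) : Prop :=
  ∃ (y : ℕ) (x : ℤ), 0 < y ∧ y ≤ M ∧ |x| ≤ y ∧ IsCoprime x (y : ℤ) ∧
    IsSquare (quarticEval f x y)

lemma sum_inv_add_le {N M : ℕ} :
    ∑ y ∈ Finset.Icc 1 M, (8 * (N : ℝ) ^ 2 * (y : ℝ)⁻¹ + 2 * y) ≤
      8 * (N : ℝ) ^ 2 * (1 + Real.log M) + 2 * (M : ℝ) ^ 2 := by
  have h1 : ∑ y ∈ Finset.Icc 1 M, (y : ℝ)⁻¹ ≤ 1 + Real.log M := by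
    have := harmonic_le_one_add_log M
    rw [harmonic_eq_sum_Icc] at this
    simpa using this
  have h2 : ∑ y ∈ Finset.Icc 1 M, (y : ℝ) ≤ (M : ℝ) ^ 2 := by
    calc ∑ y ∈ Finset.Icc 1 M, (y : ℝ) ≤ ∑ y ∈ Finset.Icc 1 M, (M : ℝ) :=
          Finset.sum_le_sum fun y hy => by exact_mod_cast (Finset.mem_Icc.1 hy).2
      _ = _ := by simp [sq]
  rw [Finset.sum_add_distrib, ← Finset.mul_sum, ← Finset.mul_sum]
  gcongr

open Classical in
lemma card_hasSmallSquareValue_le_sum {N M S : ℕ} (hN : 0 < N) (hS : 5 * N ≤ S ^ 2) :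
    ((coeffBox N).filter fun f => f 0 ≠ 0 ∧ HasSmallSquareValue M f).card ≤
      ∑ y ∈ Finset.Icc 1 M, (2 * y + 1) *
        ((2 * N / y + 1) ^ 2 * (24 * N ^ 2 * S * (y ^ 2).divisors.card ^ 2)) := by
  have hsub : ((coeffBox N).filter fun f => f 0 ≠ 0 ∧ HasSmallSquareValue M f) ⊆
      (Finset.Icc 1 M).biUnion fun y =>
        ((Finset.Icc (-(y : ℤ)) y).filter fun x => IsCoprime x (y : ℤ)).biUnion fun x =>
          (coeffBox N).filter fun f => f 0 ≠ 0 ∧ IsSquare (quarticEval f x y) := by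
    intro f hf
    obtain ⟨hbox, h0, y, x, hy, hyM, hx, hxy, hsq⟩ := Finset.mem_filter.1 hf
    simp only [Finset.mem_biUnion]
    exact ⟨y, Finset.mem_Icc.2 ⟨hy, hyM⟩, x,
      Finset.mem_filter.2 ⟨Finset.mem_Icc.2 (abs_le.1 hx), hxy⟩,
      Finset.mem_filter.2 ⟨hbox, h0, hsq⟩⟩
  refine (Finset.card_le_card hsub).trans (Finset.card_biUnion_le.trans
    (Finset.sum_le_sum fun y hy => ?_))
  refine (Finset.card_biUnion_le_card_mul _ _ _ fun x hx => ?_).trans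
    (Nat.mul_le_mul_right _ ?_)
  · obtain ⟨hx1, hx2⟩ := Finset.mem_filter.1 hx
    exact card_isSquare_eval_le hN hS (Finset.mem_Icc.1 hy).1
      (abs_le.2 (Finset.mem_Icc.1 hx1)) hx2
  · refine (Finset.card_filter_le _ _).trans ?_
    rw [Int.card_Icc]
    omega

open Classical in
lemma exists_card_hasSmallSquareValue_le {η : ℝ} (hη : 0 < η) :
    ∃ C : ℝ, 0 < C ∧ ∀ N M : ℕ, 0 < N → 0 < M → M ≤ N ^ 2 →
      (((coeffBox N).filter fun f => f 0 ≠ 0 ∧ HasSmallSquareValue M f).card : ℝ) ≤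
        C * (N : ℝ) ^ (5 / 2 + 9 * η) * ((N : ℝ) ^ 2 + (M : ℝ) ^ 2) := by
  obtain ⟨C, hC, hdiv⟩ := exists_card_divisors_le_mul_rpow hη
  refine ⟨288 * C ^ 2 * (8 * (1 + 2 / η)), by positivity, fun N M hN hM hMN => ?_⟩
  have hN1 : (1 : ℝ) ≤ N := by exact_mod_cast hN
  have hN0 : (0 : ℝ) < N := by linarith
  set S := Nat.sqrt (5 * N) + 1 with hSdef
  have hS : 5 * N ≤ S ^ 2 := (Nat.lt_succ_sqrt' (5 * N)).le
  have hS4 : (S : ℝ) ≤ 4 * (N : ℝ) ^ (1 / 2 : ℝ) := by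
    rw [← Real.sqrt_eq_rpow]
    have h1 : (Nat.sqrt (5 * N) : ℝ) ≤ Real.sqrt ((5 * N : ℕ) : ℝ) := Real.nat_sqrt_le_real_sqrt
    have h2 : Real.sqrt ((5 * N : ℕ) : ℝ) ≤ 3 * Real.sqrt N := by
      rw [Real.sqrt_le_left (by positivity), mul_pow, Real.sq_sqrt hN0.le]
      push_cast
      linarith
    have h3 : 1 ≤ Real.sqrt N := Real.one_le_sqrt.2 hN1
    rw [hSdef]
    push_cast
    linarith
  have hlog : 1 + Real.log M ≤ (1 + 2 / η) * (N : ℝ) ^ η := by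
    have h1 : Real.log M ≤ 2 * Real.log N := by
      rw [← Nat.cast_ofNat, ← Real.log_pow]
      exact Real.log_le_log (by exact_mod_cast hM) (by exact_mod_cast hMN)
    have h2 := Real.log_le_rpow_div hN0.le hη
    have h3 : 1 ≤ (N : ℝ) ^ η := Real.one_le_rpow hN1 hη.le
    calc _ ≤ (N : ℝ) ^ η + 2 * ((N : ℝ) ^ η / η) := by linarith
      _ = _ := by ring
  have hterm : ∀ y ∈ Finset.Icc 1 M, (((2 * y + 1) *
        ((2 * N / y + 1) ^ 2 * (24 * N ^ 2 * S * (y ^ 2).divisors.card ^ 2)) : ℕ) : ℝ) ≤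
      288 * C ^ 2 * (N : ℝ) ^ (5 / 2 + 8 * η) * (8 * (N : ℝ) ^ 2 * (y : ℝ)⁻¹ + 2 * y) := by
    intro y hy
    obtain ⟨hy1, hyM⟩ := Finset.mem_Icc.1 hy
    have hy1' : (1 : ℝ) ≤ y := by exact_mod_cast hy1
    have hy0 : (0 : ℝ) < y := by linarith
    have hD : ((y ^ 2).divisors.card : ℝ) ≤ C * (N : ℝ) ^ (4 * η) := by
      refine (hdiv (y ^ 2) (by positivity)).trans ?_
      rw [Real.rpow_mul hN0.le]
      gcongr
      rw [show (4 : ℝ) = (4 : ℕ) by norm_num, Real.rpow_natCast]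
      have : y ^ 2 ≤ N ^ 4 := by
        calc y ^ 2 ≤ (N ^ 2) ^ 2 := Nat.pow_le_pow_left (hyM.trans hMN) 2
          _ = N ^ 4 := by ring
      exact_mod_cast this
    have hdivle : ((2 * N / y : ℕ) : ℝ) ≤ 2 * N * (y : ℝ)⁻¹ := by
      refine Nat.cast_div_le.trans (le_of_eq ?_)
      push_cast
      ring
    have hsq : (y : ℝ) * (2 * N * (y : ℝ)⁻¹ + 1) ^ 2 ≤ 8 * (N : ℝ) ^ 2 * (y : ℝ)⁻¹ + 2 * y := by
      have h1 : (2 * N * (y : ℝ)⁻¹ + 1) ^ 2 ≤ 2 * (2 * N * (y : ℝ)⁻¹) ^ 2 + 2 := by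
        nlinarith [sq_nonneg (2 * N * (y : ℝ)⁻¹ - 1)]
      calc _ ≤ (y : ℝ) * (2 * (2 * N * (y : ℝ)⁻¹) ^ 2 + 2) := by gcongr
        _ = _ := by field_simp
                    ring
    have hpow : (N : ℝ) ^ (5 / 2 + 8 * η) =
        (N : ℝ) ^ 2 * (N : ℝ) ^ (1 / 2 : ℝ) * ((N : ℝ) ^ (4 * η)) ^ 2 := by
      rw [← Real.rpow_natCast, ← Real.rpow_natCast, ← Real.rpow_mul hN0.le,
        ← Real.rpow_add hN0, ← Real.rpow_add hN0]
      congr 1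
      push_cast
      ring
    push_cast
    calc _ ≤ (2 * (y : ℝ) + y) * ((2 * N * (y : ℝ)⁻¹ + 1) ^ 2 *
          (24 * (N : ℝ) ^ 2 * (4 * (N : ℝ) ^ (1 / 2 : ℝ)) * (C * (N : ℝ) ^ (4 * η)) ^ 2)) := by
          gcongr
      _ = 288 * C ^ 2 * ((N : ℝ) ^ 2 * (N : ℝ) ^ (1 / 2 : ℝ) * ((N : ℝ) ^ (4 * η)) ^ 2) *
          ((y : ℝ) * (2 * N * (y : ℝ)⁻¹ + 1) ^ 2) := by ring
      _ ≤ _ := by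
          rw [hpow]
          gcongr
  have hcard := card_hasSmallSquareValue_le_sum (M := M) hN hS
  calc _ ≤ ∑ y ∈ Finset.Icc 1 M, (((2 * y + 1) *
        ((2 * N / y + 1) ^ 2 * (24 * N ^ 2 * S * (y ^ 2).divisors.card ^ 2)) : ℕ) : ℝ) := by
        exact_mod_cast hcard
    _ ≤ ∑ y ∈ Finset.Icc 1 M, 288 * C ^ 2 * (N : ℝ) ^ (5 / 2 + 8 * η) *
        (8 * (N : ℝ) ^ 2 * (y : ℝ)⁻¹ + 2 * y) := Finset.sum_le_sum hterm
    _ ≤ 288 * C ^ 2 * (N : ℝ) ^ (5 / 2 + 8 * η) *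
        (8 * (N : ℝ) ^ 2 * ((1 + 2 / η) * (N : ℝ) ^ η) +
          8 * (M : ℝ) ^ 2 * ((1 + 2 / η) * (N : ℝ) ^ η)) := by
        rw [← Finset.mul_sum]
        gcongr
        refine sum_inv_add_le.trans ?_
        have h1 : 1 ≤ (1 + 2 / η) * (N : ℝ) ^ η :=
          one_le_mul_of_one_le_of_one_le (by
            have : 0 < 2 / η := by positivity
            linarith) (Real.one_le_rpow hN1 hη.le)
        have h2 : 2 * (M : ℝ) ^ 2 ≤ 8 * (M : ℝ) ^ 2 * ((1 + 2 / η) * (N : ℝ) ^ η) := by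
          nlinarith [sq_nonneg (M : ℝ)]
        gcongr
    _ = _ := by
        rw [show 5 / 2 + 9 * η = (5 / 2 + 8 * η) + η by ring, Real.rpow_add hN0 (5 / 2 + 8 * η)]
        ring

open Classical in
lemma exists_card_hasSmallSquareValue_floor_le {δ : ℝ} (hδ : 0 < δ) (hδ' : δ ≤ 1 / 8) :
    ∃ C : ℝ, 0 < C ∧ ∀ N : ℕ, 0 < N →
      (((coeffBox N).filter fun f => f 0 ≠ 0 ∧
        HasSmallSquareValue ⌊(N : ℝ) ^ (5 / 4 - δ)⌋₊ f).card : ℝ) ≤ C * (N : ℝ) ^ (5 - δ) := by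
  obtain ⟨C, hC, h⟩ := exists_card_hasSmallSquareValue_le (η := δ / 9) (by positivity)
  refine ⟨C * 2, by positivity, fun N hN => ?_⟩
  have hN1 : (1 : ℝ) ≤ N := by exact_mod_cast hN
  have hN0 : (0 : ℝ) < N := by linarith
  set M := ⌊(N : ℝ) ^ (5 / 4 - δ)⌋₊ with hM
  have hMle : (M : ℝ) ≤ (N : ℝ) ^ (5 / 4 - δ) := Nat.floor_le (by positivity)
  have hMpos : 0 < M := Nat.floor_pos.2 (Real.one_le_rpow hN1 (by linarith))
  have hMN : M ≤ N ^ 2 := by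
    have : (M : ℝ) ≤ (N : ℝ) ^ (2 : ℝ) :=
      hMle.trans (Real.rpow_le_rpow_of_exponent_le hN1 (by linarith))
    rw [Real.rpow_two] at this
    exact_mod_cast this
  have e1 : (N : ℝ) ^ (5 / 2 + 9 * (δ / 9)) * (N : ℝ) ^ 2 ≤ (N : ℝ) ^ (5 - δ) := by
    rw [← Real.rpow_two, ← Real.rpow_add hN0]
    exact Real.rpow_le_rpow_of_exponent_le hN1 (by linarith)
  have e2 : (N : ℝ) ^ (5 / 2 + 9 * (δ / 9)) * (M : ℝ) ^ 2 ≤ (N : ℝ) ^ (5 - δ) := by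
    calc _ ≤ (N : ℝ) ^ (5 / 2 + 9 * (δ / 9)) * ((N : ℝ) ^ (5 / 4 - δ)) ^ 2 := by gcongr
      _ = _ := by
        rw [← Real.rpow_natCast, ← Real.rpow_mul hN0.le, ← Real.rpow_add hN0]
        congr 1
        push_cast
        ring
  calc _ ≤ C * (N : ℝ) ^ (5 / 2 + 9 * (δ / 9)) * ((N : ℝ) ^ 2 + (M : ℝ) ^ 2) := h N M hN hMpos hMN
    _ = C * ((N : ℝ) ^ (5 / 2 + 9 * (δ / 9)) * (N : ℝ) ^ 2 +
        (N : ℝ) ^ (5 / 2 + 9 * (δ / 9)) * (M : ℝ) ^ 2) := by ring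
    _ ≤ C * ((N : ℝ) ^ (5 - δ) + (N : ℝ) ^ (5 - δ)) := by gcongr
    _ = _ := by ring

lemma quarticEval_rev (f : Fin 5 → ℤ) (x y : ℤ) :
    quarticEval (fun i => f i.rev) y x = quarticEval f x y := by
  rw [quarticEval_eq, quarticEval_eq]
  simp only [show (0 : Fin 5).rev = 4 from rfl, show (1 : Fin 5).rev = 3 from rfl,
    show (2 : Fin 5).rev = 2 from rfl, show (3 : Fin 5).rev = 1 from rfl,
    show (4 : Fin 5).rev = 0 from rfl]
  ring

lemma hasSmallSquareValue_of_abs_le {M : ℕ} {f : Fin 5 → ℤ} {x y : ℤ} (hxy : IsCoprime x y)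
    (hle : |x| ≤ |y|) (hy : y.natAbs ≤ M) (hsq : IsSquare (quarticEval f x y)) :
    HasSmallSquareValue M f := by
  have hy0 : y ≠ 0 := by
    rintro rfl
    rw [abs_zero] at hle
    rw [abs_nonpos_iff.1 hle] at hxy
    exact not_isCoprime_zero_zero hxy
  have hpos : 0 < y.natAbs := Int.natAbs_pos.2 hy0
  rcases Int.natAbs_eq y with h | h
  · refine ⟨y.natAbs, x, hpos, hy, ?_, ?_, ?_⟩
    · rwa [Int.natCast_natAbs]
    · rwa [← h]
    · rwa [← h]
  · have h' : (y.natAbs : ℤ) = -y := by omega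
    refine ⟨y.natAbs, -x, hpos, hy, ?_, ?_, ?_⟩
    · rwa [Int.natCast_natAbs, abs_neg]
    · rw [h']
      exact hxy.neg_neg
    · rw [h']
      convert hsq using 1
      rw [quarticEval_eq, quarticEval_eq]
      ring

/-- Every rational point on `z² = f(x, y)` has large height. -/
def HasNoSmallPoint (ε : ℝ) (f : Fin 5 → ℤ) : Prop :=
  ∀ x y : ℤ, IsCoprime x y → ∀ z : ℚ, z ^ 2 = (quarticEval f x y : ℚ) →
    (5 / 4 - ε) * Real.log (quarticHt f) ≤ Real.log (max |(x : ℝ)| |(y : ℝ)|)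

lemma hasSmallSquareValue_of_not_hasNoSmallPoint {ε δ : ℝ} (hδ : δ ≤ ε) (hδ' : δ ≤ 5 / 4)
    {N : ℕ} (hN : 0 < N) {f : Fin 5 → ℤ} (hf : f ∈ coeffBox N) (h : ¬ HasNoSmallPoint ε f) :
    HasSmallSquareValue ⌊(N : ℝ) ^ (5 / 4 - δ)⌋₊ f ∨
      HasSmallSquareValue ⌊(N : ℝ) ^ (5 / 4 - δ)⌋₊ (fun i => f i.rev) := by
  have hN0 : (0 : ℝ) < N := by exact_mod_cast hN
  rw [HasNoSmallPoint] at h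
  push Not at h
  obtain ⟨x, y, hxy, z, hz, hlt⟩ := h
  have hsq : IsSquare (quarticEval f x y) := by
    rw [← Rat.isSquare_intCast_iff]
    exact ⟨z, by rw [← hz, sq]⟩
  have hHt0 : 0 ≤ quarticHt f :=
    (abs_nonneg (f 0)).trans (Finset.le_sup' (fun i => |f i|) (Finset.mem_univ 0))
  have hHtN : quarticHt f ≤ N := Finset.sup'_le _ _ fun i _ => mem_coeffBox.1 hf i
  have hlog0 : 0 ≤ Real.log (quarticHt f) := Real.log_intCast_nonneg _
  have hlogN : Real.log (quarticHt f) ≤ Real.log N := by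
    rcases hHt0.eq_or_lt with h0 | h0
    · rw [← h0]
      simpa using Real.log_natCast_nonneg N
    · exact Real.log_le_log (by exact_mod_cast h0) (by exact_mod_cast hHtN)
  have hmaxpos : 0 < max |(x : ℝ)| |(y : ℝ)| := by
    rcases hxy.ne_zero_or_ne_zero with hx | hy
    · exact lt_max_of_lt_left (abs_pos.2 (by exact_mod_cast hx))
    · exact lt_max_of_lt_right (abs_pos.2 (by exact_mod_cast hy))
  have hmax : max |(x : ℝ)| |(y : ℝ)| ≤ (N : ℝ) ^ (5 / 4 - δ) := by
    rw [← Real.log_le_log_iff hmaxpos (by positivity), Real.log_rpow hN0]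
    calc _ ≤ (5 / 4 - ε) * Real.log (quarticHt f) := hlt.le
      _ ≤ (5 / 4 - δ) * Real.log (quarticHt f) := by gcongr
      _ ≤ (5 / 4 - δ) * Real.log N := by
        have : 0 ≤ 5 / 4 - δ := by linarith
        gcongr
  have hnat : ∀ w : ℤ, |(w : ℝ)| ≤ (N : ℝ) ^ (5 / 4 - δ) →
      w.natAbs ≤ ⌊(N : ℝ) ^ (5 / 4 - δ)⌋₊ := fun w hw => by
    refine Nat.le_floor ?_
    rwa [Nat.cast_natAbs, Int.cast_abs]
  rcases le_total |x| |y| with hle | hle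
  · exact Or.inl (hasSmallSquareValue_of_abs_le hxy hle
      (hnat y ((le_max_right _ _).trans hmax)) hsq)
  · refine Or.inr (hasSmallSquareValue_of_abs_le hxy.symm hle
      (hnat x ((le_max_left _ _).trans hmax)) ?_)
    rwa [quarticEval_rev]

open Classical in
lemma exists_card_not_hasNoSmallPoint_le {ε : ℝ} (hε : 0 < ε) :
    ∃ δ : ℝ, 0 < δ ∧ ∃ C : ℝ, 0 < C ∧ ∀ N : ℕ, 0 < N →
      (((coeffBox N).filter fun f => ¬ HasNoSmallPoint ε f).card : ℝ) ≤
        C * (N : ℝ) ^ (5 - δ) := by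
  set δ := min ε (1 / 8) with hδ
  have hδ0 : 0 < δ := lt_min hε (by norm_num)
  have hδ8 : δ ≤ 1 / 8 := min_le_right _ _
  obtain ⟨C, hC, h⟩ := exists_card_hasSmallSquareValue_floor_le hδ0 hδ8
  refine ⟨δ, hδ0, 2 * (81 + C), by positivity, fun N hN => ?_⟩
  have hN1 : (1 : ℝ) ≤ N := by exact_mod_cast hN
  set M := ⌊(N : ℝ) ^ (5 / 4 - δ)⌋₊ with hM
  set V := (coeffBox N).filter fun f => f 0 ≠ 0 ∧ HasSmallSquareValue M f with hV
  set Z := fun i : Fin 5 => (coeffBox N).filter fun f => f i = 0 with hZ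
  have hsub : ((coeffBox N).filter fun f => ¬ HasNoSmallPoint ε f) ⊆
      (Z 0 ∪ Z 4) ∪ (V ∪ V.image fun f i => f i.rev) := by
    intro f hf
    obtain ⟨hbox, hbad⟩ := Finset.mem_filter.1 hf
    simp only [Finset.mem_union]
    by_cases h0 : f 0 = 0
    · exact Or.inl (Or.inl (Finset.mem_filter.2 ⟨hbox, h0⟩))
    by_cases h4 : f 4 = 0
    · exact Or.inl (Or.inr (Finset.mem_filter.2 ⟨hbox, h4⟩))
    rcases hasSmallSquareValue_of_not_hasNoSmallPoint (min_le_left ε (1 / 8)) (by linarith)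
      hN hbox hbad with hs | hs
    · exact Or.inr (Or.inl (Finset.mem_filter.2 ⟨hbox, h0, hs⟩))
    · refine Or.inr (Or.inr (Finset.mem_image.2 ⟨fun i => f i.rev,
        Finset.mem_filter.2 ⟨?_, h4, hs⟩, by simp⟩))
      exact mem_coeffBox.2 fun i => mem_coeffBox.1 hbox _
  have hcard : ((coeffBox N).filter fun f => ¬ HasNoSmallPoint ε f).card ≤
      ((2 * N + 1) ^ 4 + (2 * N + 1) ^ 4) + (V.card + V.card) := by
    refine (Finset.card_le_card hsub).trans ((Finset.card_union_le _ _).trans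
      (Nat.add_le_add ((Finset.card_union_le _ _).trans (Nat.add_le_add ?_ ?_))
        ((Finset.card_union_le _ _).trans (Nat.add_le_add_left Finset.card_image_le _))))
    · exact card_coeff_eq_zero_le N 0
    · exact card_coeff_eq_zero_le N 4
  have h81 : (2 * (N : ℝ) + 1) ^ 4 ≤ 81 * (N : ℝ) ^ (5 - δ) := by
    calc (2 * (N : ℝ) + 1) ^ 4 ≤ (3 * (N : ℝ)) ^ 4 := by gcongr; linarith
      _ = 81 * (N : ℝ) ^ (4 : ℝ) := by
        rw [show (4 : ℝ) = (4 : ℕ) by norm_num, Real.rpow_natCast]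
        ring
      _ ≤ _ := by
        gcongr
        linarith
  have hcard' : (((coeffBox N).filter fun f => ¬ HasNoSmallPoint ε f).card : ℝ) ≤
      ((2 * (N : ℝ) + 1) ^ 4 + (2 * (N : ℝ) + 1) ^ 4) + (V.card + V.card) := by
    exact_mod_cast hcard
  have := h N hN
  linarith

open Classical in
lemma pow_le_card_squarefree {N : ℕ} (hN : 3 ≤ N) :
    N ^ 5 ≤ ((coeffBox N).filter fun f => Squarefree (quarticForm f)).card := by
  have hsub : coeffBox N ⊆ ((coeffBox N).filter fun f => Squarefree (quarticForm f)) ∪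
      (((coeffBox N).filter fun f => f 0 = 0) ∪
        (coeffBox N).filter fun f => f 0 ≠ 0 ∧ ¬ Squarefree (quarticForm f)) := by
    intro f hf
    simp only [Finset.mem_union, Finset.mem_filter]
    tauto
  have h1 := (Finset.card_le_card hsub).trans ((Finset.card_union_le _ _).trans
    (Nat.add_le_add_left (Finset.card_union_le _ _) _))
  rw [card_coeffBox] at h1
  have h2 := card_coeff_eq_zero_le N 0
  have h3 := card_not_squarefree_le N
  have h4 : N ^ 5 + 4 * (2 * N + 1) ^ 4 ≤ (2 * N + 1) ^ 5 := by
    calc N ^ 5 + 4 * (2 * N + 1) ^ 4 = N ^ 4 * N + (2 * N + 1) ^ 4 * 4 := by ring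
      _ ≤ (2 * N + 1) ^ 4 * N + (2 * N + 1) ^ 4 * 4 := by gcongr; omega
      _ = (2 * N + 1) ^ 4 * (N + 4) := by ring
      _ ≤ (2 * N + 1) ^ 4 * (2 * N + 1) := Nat.mul_le_mul_left _ (by omega)
      _ = _ := by ring
  omega

open Classical in
lemma tendsto_card_hasNoSmallPoint_div {ε : ℝ} (hε : 0 < ε) :
    Tendsto (fun N : ℕ =>
      (((coeffBox N).filter fun f => Squarefree (quarticForm f) ∧ HasNoSmallPoint ε f).card : ℝ) /
        ((coeffBox N).filter fun f => Squarefree (quarticForm f)).card) atTop (nhds 1) := by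
  obtain ⟨δ, hδ, C, hC, hbad⟩ := exists_card_not_hasNoSmallPoint_le hε
  have hlim : Tendsto (fun N : ℕ => 1 - C * (N : ℝ) ^ (-δ)) atTop (nhds 1) := by
    have h1 := (tendsto_rpow_neg_atTop hδ).comp (tendsto_natCast_atTop_atTop (R := ℝ))
    simpa using (h1.const_mul C).const_sub 1
  refine tendsto_of_tendsto_of_tendsto_of_le_of_le' hlim tendsto_const_nhds ?_ ?_
  · filter_upwards [eventually_ge_atTop 3] with N hN
    have hN0 : (0 : ℝ) < N := by exact_mod_cast (by omega : 0 < N)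
    set A := ((coeffBox N).filter fun f =>
      Squarefree (quarticForm f) ∧ HasNoSmallPoint ε f) with hA
    set B := ((coeffBox N).filter fun f => Squarefree (quarticForm f)) with hB
    set W := ((coeffBox N).filter fun f => ¬ HasNoSmallPoint ε f) with hW
    have hBN : (N : ℝ) ^ 5 ≤ B.card := by exact_mod_cast pow_le_card_squarefree hN
    have hB0 : (0 : ℝ) < B.card := lt_of_lt_of_le (by positivity) hBN
    have hBA : (B.card : ℝ) ≤ A.card + W.card := by
      have hsub : B ⊆ A ∪ W := by
        intro f hf
        simp only [hA, hB, hW, Finset.mem_union, Finset.mem_filter] at hf ⊢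
        tauto
      exact_mod_cast (Finset.card_le_card hsub).trans (Finset.card_union_le _ _)
    have hWB : (W.card : ℝ) ≤ C * (N : ℝ) ^ (-δ) * B.card := by
      calc (W.card : ℝ) ≤ C * (N : ℝ) ^ (5 - δ) := hbad N (by omega)
        _ = C * (N : ℝ) ^ (-δ) * (N : ℝ) ^ 5 := by
          rw [← Real.rpow_natCast, mul_assoc, ← Real.rpow_add hN0]
          congr 2
          push_cast
          ring
        _ ≤ _ := by gcongr
    rw [le_div_iff₀ hB0]
    linarith
  · refine Eventually.of_forall fun N => div_le_one_of_le₀ ?_ (by positivity)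
    rw [Nat.cast_le]
    exact Finset.card_le_card (Finset.monotone_filter_right _ fun f _ hf => hf.1)

lemma tendsto_ceil_sub_one_atTop : Tendsto (fun X : ℝ => ⌈X⌉₊ - 1) atTop atTop :=
  (tendsto_sub_atTop_nat 1).comp tendsto_nat_ceil_atTop

lemma forall_abs_lt_iff_mem_coeffBox {X : ℝ} (hX : 0 < X) (f : Fin 5 → ℤ) :
    (∀ i, (|f i| : ℝ) < X) ↔ f ∈ coeffBox (⌈X⌉₊ - 1) := by
  rw [mem_coeffBox]
  refine forall_congr' fun i => ?_
  have hpos : 0 < ⌈X⌉₊ := Nat.ceil_pos.2 hX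
  rw [← Int.cast_abs, Int.abs_eq_natAbs, Int.cast_natCast, ← Nat.lt_ceil]
  omega

/-- for every `ε > 0`, among integral binary quartic forms `f` of nonzero
discriminant (i.e. squarefree over `ℚ`) ordered by height, the forms such that every rational
point `(x:y:z)` (with `x, y` coprime integers and `z ∈ ℚ`) on `z² = f(x,y)` satisfies
`log max(|x|,|y|) ≥ (5/4 − ε)·log Ht(f)` have density `1`. -/
theorem density_one_no_small_rational_points_quartic (ε : ℝ) (hε : 0 < ε) :
    Tendsto (fun X : ℝ =>
      ((Nat.card {f : Fin 5 → ℤ | (∀ i, (|f i| : ℝ) < X) ∧ Squarefree (quarticForm f) ∧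
          ∀ x y : ℤ, IsCoprime x y → ∀ z : ℚ, z ^ 2 = (quarticEval f x y : ℚ) →
            (5 / 4 - ε) * Real.log (quarticHt f) ≤
              Real.log (max |(x : ℝ)| |(y : ℝ)|)} : ℝ) /
        (Nat.card {f : Fin 5 → ℤ | (∀ i, (|f i| : ℝ) < X) ∧ Squarefree (quarticForm f)} : ℝ)))
      atTop (nhds 1) := by
  classical
  refine ((tendsto_card_hasNoSmallPoint_div hε).comp tendsto_ceil_sub_one_atTop).congr' ?_
  filter_upwards [eventually_gt_atTop 0] with X hX
  simp only [Function.comp_apply, forall_abs_lt_iff_mem_coeffBox hX]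
  congr 2 <;> rw [← Nat.card_eq_finsetCard] <;> simp only [Finset.mem_filter] <;> rfl
end

section
/- Let K be an algebraically closed field of characteristic 0, let n ≥ 2, and let f(x,y) be a homogeneous polynomial of degree n over K which is squarefree (i.e. has nonzero discriminant). Then there exists a pair (A,B) of symmetric n×n matrices over K whose invariant binary form equals f, i.e. (−1)^{n(n−1)/2}·det(A·x − B·y) = f(x,y). -/
open MvPolynomial Matrix

/-- The invariant binary form of a pair of `n × n` matrices `(A, B)` over a commutative ring:
`f_{A,B}(x,y) = (-1)^(n(n-1)/2) · det(A·x - B·y)`, as a polynomial in the two variables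
`X 0` (playing the role of `x`) and `X 1` (playing the role of `y`). -/
noncomputable def invBinForm {R : Type*} [CommRing R] (n : ℕ)
    (A B : Matrix (Fin n) (Fin n) R) : MvPolynomial (Fin 2) R :=
  (-1) ^ (n * (n - 1) / 2) *
    (Matrix.of fun i j => C (A i j) * X 0 - C (B i j) * X 1).det

/-- Over an algebraically closed field, the homogenization of a polynomial is a scalar multiple of
a product of linear forms. -/
theorem exists_homogenize_eq_C_mul_prod {K : Type*} [Field K] [IsAlgClosed K] (n : ℕ)
    (p : Polynomial K) (hp : p.natDegree ≤ n) :
    ∃ (c : K) (a b : Fin n → K),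
      p.homogenize n = C c * ∏ i, (C (a i) * X 0 - C (b i) * X 1) := by
  induction n generalizing p with
  | zero =>
    obtain ⟨c, rfl⟩ := Polynomial.natDegree_eq_zero.mp (Nat.le_zero.mp hp)
    exact ⟨c, 0, 0, by simp⟩
  | succ n ih =>
    by_cases hpn : p.natDegree ≤ n
    · obtain ⟨c, a, b, h⟩ := ih p hpn
      refine ⟨c, Fin.cons 0 a, Fin.cons (-1) b, ?_⟩
      have hmul := Polynomial.homogenize_mul p 1 (n := 1) hpn (by simp)
      rw [mul_one] at hmul
      rw [hmul, h, Fin.prod_univ_succ]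
      simp only [Polynomial.homogenize_one, Fin.cons_zero, Fin.cons_succ, map_neg, map_zero, map_one]
      ring
    · obtain ⟨r, hr⟩ := IsAlgClosed.exists_root p fun h =>
        hpn ((Polynomial.natDegree_eq_of_degree_eq_some h).trans_le n.zero_le)
      obtain ⟨q, rfl⟩ := Polynomial.dvd_iff_isRoot.mpr hr
      have hq : q.natDegree ≤ n := by
        rcases eq_or_ne q 0 with rfl | hq0
        · simp
        · rw [Polynomial.natDegree_mul (Polynomial.X_sub_C_ne_zero r) hq0,
            Polynomial.natDegree_X_sub_C] at hp
          omega
      obtain ⟨c, a, b, h⟩ := ih q hq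
      refine ⟨c, Fin.cons 1 a, Fin.cons r b, ?_⟩
      rw [mul_comm, Polynomial.homogenize_mul q _ hq (Polynomial.natDegree_X_sub_C r).le, h,
        Fin.prod_univ_succ]
      simp only [Polynomial.homogenize_sub, Polynomial.homogenize_X one_ne_zero,
        Polynomial.homogenize_C, Fin.cons_zero, Fin.cons_succ, map_one]
      ring

/-- The invariant binary form of a pair of diagonal matrices. -/
theorem invBinForm_diagonal {R : Type*} [CommRing R] (n : ℕ) (a b : Fin n → R) :
    invBinForm n (diagonal a) (diagonal b) =
      (-1) ^ (n * (n - 1) / 2) * ∏ i, (C (a i) * X 0 - C (b i) * X 1) := by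
  rw [invBinForm, ← det_diagonal]
  congr 2
  ext1 i j
  by_cases h : i = j
  · subst h
    simp
  · simp [h]

/-- over an algebraically closed field of characteristic zero, every squarefree
binary form of degree `n ≥ 2` arises as the invariant binary form of a pair of symmetric
matrices. -/
theorem exists_pair_symm_matrices_with_invariant_form
    {K : Type*} [Field K] [IsAlgClosed K] [CharZero K] (n : ℕ) (hn : 2 ≤ n)
    (f : MvPolynomial (Fin 2) K) (hhom : f.IsHomogeneous n) (hsf : Squarefree f) :
    ∃ A B : Matrix (Fin n) (Fin n) K, A.IsSymm ∧ B.IsSymm ∧ invBinForm n A B = f := by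
  have hdeg : (aeval ![(Polynomial.X : Polynomial K), 1] f).natDegree ≤ n := by
    refine (aeval_natDegree_le f hhom.totalDegree_le _ (n := 1) fun i => ?_).trans (by simp)
    fin_cases i <;> simp
  obtain ⟨c, a, b, h⟩ := exists_homogenize_eq_C_mul_prod n _ hdeg
  rw [Polynomial.homogenize_eq_of_isHomogeneous hhom rfl] at h
  obtain ⟨d, hd⟩ := IsAlgClosed.exists_pow_nat_eq ((-1) ^ (n * (n - 1) / 2) * c)
    (show 0 < n by omega)
  refine ⟨diagonal (d • a), diagonal (d • b), isSymm_diagonal _, isSymm_diagonal _, ?_⟩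
  have hprod : ∏ i, (C ((d • a) i) * X 0 - C ((d • b) i) * X 1) =
      (C d ^ n * ∏ i, (C (a i) * X 0 - C (b i) * X 1) : MvPolynomial (Fin 2) K) := by
    simp only [Pi.smul_apply, smul_eq_mul, C_mul, mul_assoc, ← mul_sub, Finset.prod_mul_distrib,
      Finset.prod_const, Finset.card_univ, Fintype.card_fin]
  rw [invBinForm_diagonal, hprod, ← C_pow, hd, h]
  simp only [C_mul, C_pow, map_neg, map_one, ← mul_assoc, ← mul_pow, neg_mul_neg, one_pow, one_mul]
end

section
/- Let K be an algebraically closed field of characteristic 0, let n ≥ 2, and let f(x,y) be a squarefree homogeneous polynomial of degree n over K. If (A,B) and (A′,B′) are two pairs of symmetric n×n matrices over K with (−1)^{n(n−1)/2}·det(A·x − B·y) = f(x,y) = (−1)^{n(n−1)/2}·det(A′·x − B′·y), then they lie in the same SL_n(K)-orbit: there exists g with det g = 1 such that gᵗA′g = A and gᵗB′g = B. -/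
open MvPolynomial Matrix

/-- The invariant binary form, up to sign, specializes to the determinants of the members of the
pencil over any commutative algebra. -/
theorem det_pencil_eq_aeval_invBinForm {K S : Type*} [CommRing K] [CommRing S] [Algebra K S]
    (n : ℕ) (A B : Matrix (Fin n) (Fin n) K) (u v : S) :
    (u • A.map (algebraMap K S) - v • B.map (algebraMap K S)).det =
      (-1) ^ (n * (n - 1) / 2) * aeval ![u, v] (invBinForm n A B) := by
  have h : aeval ![u, v]
      (Matrix.of fun i j => C (A i j) * X 0 - C (B i j) * X 1 :
        Matrix (Fin n) (Fin n) (MvPolynomial (Fin 2) K)).det =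
      (u • A.map (algebraMap K S) - v • B.map (algebraMap K S)).det := by
    rw [AlgHom.map_det]
    congr 1
    ext i j
    simp [mul_comm]
  rw [invBinForm, map_mul, h, map_pow, map_neg, map_one, ← mul_assoc, ← mul_pow]
  simp

/-- Over an algebraically closed field, the homogenized characteristic polynomial is a product of
linear forms. -/
theorem det_smul_one_sub_smul_eq_prod_roots_of_field {K L : Type*} [Field K] [IsAlgClosed K] [Field L]
    [Algebra K L] {n : ℕ} (T : Matrix (Fin n) (Fin n) K) (u : L) {v : L} (hv : v ≠ 0) :
    (u • (1 : Matrix (Fin n) (Fin n) L) - v • T.map (algebraMap K L)).det =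
      (T.charpoly.roots.map fun a => u - algebraMap K L a * v).prod := by
  have hs := IsAlgClosed.splits T.charpoly
  have hcard : T.charpoly.roots.card = n := by
    rw [← hs.natDegree_eq_card_roots, Matrix.charpoly_natDegree_eq_dim, Fintype.card_fin]
  have h1 : u • (1 : Matrix (Fin n) (Fin n) L) - v • T.map (algebraMap K L) =
      v • (scalar (Fin n) (u / v) - T.map (algebraMap K L)) := by
    rw [smul_sub, scalar_apply, ← smul_one_eq_diagonal, smul_smul, mul_div_cancel₀ _ hv]
  have h2 : (T.map (algebraMap K L)).charpoly.eval (u / v) =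
      (T.charpoly.roots.map fun a => u / v - algebraMap K L a).prod := by
    rw [Matrix.charpoly_map,
      (hs.map (algebraMap K L)).eval_eq_prod_roots_of_monic (T.charpoly_monic.map _),
      hs.roots_map, Multiset.map_map]
    rfl
  have h3 : (T.charpoly.roots.map fun _ => v).prod = v ^ n := by
    rw [Multiset.map_const', Multiset.prod_replicate, hcard]
  rw [h1, det_smul, ← Matrix.eval_charpoly, h2, Fintype.card_fin, ← h3, ← Multiset.prod_map_mul]
  congr 1
  refine Multiset.map_congr rfl fun a _ => ?_
  field_simp

/-- Over an algebraically closed field, the homogenized characteristic polynomial is a product of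
linear forms; version over a domain `S` with fraction field `L`. -/
theorem det_smul_one_sub_smul_eq_prod_roots {K S : Type*} (L : Type*) [Field K] [IsAlgClosed K]
    [CommRing S] [Field L] [Algebra K S] [Algebra S L] [IsFractionRing S L] [Algebra K L]
    [IsScalarTower K S L] {n : ℕ} (T : Matrix (Fin n) (Fin n) K) (u : S) {v : S} (hv : v ≠ 0) :
    (u • (1 : Matrix (Fin n) (Fin n) S) - v • T.map (algebraMap K S)).det =
      (T.charpoly.roots.map fun a => u - algebraMap K S a * v).prod := by
  have hinj := IsFractionRing.injective S L
  apply hinj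
  have hv' : algebraMap S L v ≠ 0 := (map_ne_zero_iff _ hinj).2 hv
  have h := det_smul_one_sub_smul_eq_prod_roots_of_field T (algebraMap S L u) hv'
  rw [map_multiset_prod, Multiset.map_map, RingHom.map_det]
  convert h using 2
  · ext i j
    simp [Matrix.one_apply, apply_ite (algebraMap S L), IsScalarTower.algebraMap_apply K S L,
      -algebraMap_smul]
  · refine Multiset.map_congr rfl fun a _ => ?_
    simp [IsScalarTower.algebraMap_apply K S L]

/-- Replacing `A` by an invertible combination `s • A - t • B` amounts to a linear substitution in
the invariant binary form. -/
theorem det_mul_det_smul_one_sub_smul {K S : Type*} [CommRing K] [CommRing S] [Algebra K S]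
    {n : ℕ} (A B : Matrix (Fin n) (Fin n) K) {s t : K} (h : IsUnit (s • A - t • B).det) (u v : S) :
    algebraMap K S (s • A - t • B).det *
        (u • (1 : Matrix (Fin n) (Fin n) S) -
          v • ((s • A - t • B)⁻¹ * B).map (algebraMap K S)).det =
      (-1) ^ (n * (n - 1) / 2) *
        aeval ![algebraMap K S s * u, algebraMap K S t * u + v] (invBinForm n A B) := by
  rw [← det_pencil_eq_aeval_invBinForm, RingHom.map_det, ← det_mul, RingHom.mapMatrix_apply,
    Matrix.mul_sub, Matrix.mul_smul, Matrix.mul_smul, ← Matrix.map_mul,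
    Matrix.mul_nonsing_inv_cancel_left _ _ h, Matrix.mul_one]
  congr 1
  ext i j
  simp
  ring

/-- If the invariant binary form of `(A, B)` is squarefree, the eigenvalues of
`(s • A - t • B)⁻¹ * B` are distinct. -/
theorem nodup_roots_charpoly_of_squarefree {K : Type*} [Field K] [IsAlgClosed K] {n : ℕ}
    {A B : Matrix (Fin n) (Fin n) K} (hsf : Squarefree (invBinForm n A B)) {s t : K} (hs : s ≠ 0)
    (h : IsUnit (s • A - t • B).det) :
    ((s • A - t • B)⁻¹ * B).charpoly.roots.Nodup := by
  set M := s • A - t • B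
  set U : MvPolynomial (Fin 2) K := C s⁻¹ * X 0 with hU
  set V : MvPolynomial (Fin 2) K := X 1 - C t * U with hV
  have hev : ∀ a, eval ![s * a, t * a + 1] U = a ∧ eval ![s * a, t * a + 1] V = 1 := fun a => by
    have hUa : eval ![s * a, t * a + 1] U = a := by simp [hU, hs]
    exact ⟨hUa, by simp [hV, hUa]⟩
  have hV0 : V ≠ 0 := fun h0 => by simpa [h0] using (hev 0).2
  have hsU : C s * U = X 0 := by
    rw [hU, ← mul_assoc, ← C_mul, mul_inv_cancel₀ hs, C_1, one_mul]
  have hfac : (-1) ^ (n * (n - 1) / 2) * invBinForm n A B =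
      C M.det * ((M⁻¹ * B).charpoly.roots.map fun a => U - C a * V).prod := by
    have h1 := det_mul_det_smul_one_sub_smul A B h U V
    rw [algebraMap_eq, hsU, hV, add_sub_cancel, ← hV, ← algebraMap_eq] at h1
    have hX : ![X 0, X 1] = (X : Fin 2 → MvPolynomial (Fin 2) K) := by
      ext i : 1
      fin_cases i <;> rfl
    rw [hX, aeval_X_left_apply] at h1
    rw [← h1, algebraMap_eq]
    congr 1
    exact det_smul_one_sub_smul_eq_prod_roots (FractionRing (MvPolynomial (Fin 2) K))
      (M⁻¹ * B) U hV0
  rw [Multiset.nodup_iff_le]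
  intro a ha
  obtain ⟨r, hr⟩ := Multiset.le_iff_exists_add.1 ha
  have hdvd : (U - C a * V) * (U - C a * V) ∣ invBinForm n A B := by
    have hu : IsUnit ((-1 : MvPolynomial (Fin 2) K) ^ (n * (n - 1) / 2)) :=
      isUnit_one.neg.pow _
    rw [← hu.dvd_mul_left, hfac, hr]
    simp only [Multiset.cons_add, Multiset.map_cons, Multiset.prod_cons]
    rw [← mul_assoc (U - C a * V)]
    exact Dvd.intro _ (mul_left_comm _ _ _)
  have hunit := (hsf _ hdvd).map (eval ![s * a, t * a + 1])
  simp [hev a] at hunit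

/-- A nonzero polynomial in two variables is nonzero at some point with nonzero first
coordinate. -/
theorem exists_eval_ne_zero_fst_ne_zero {K : Type*} [Field K] [Infinite K]
    {f : MvPolynomial (Fin 2) K} (hf : f ≠ 0) :
    ∃ s t : K, s ≠ 0 ∧ eval ![s, t] f ≠ 0 := by
  by_contra! h
  have h0 : f * X 0 = 0 := by
    refine MvPolynomial.funext fun x => ?_
    have hx : x = ![x 0, x 1] := by ext i; fin_cases i <;> rfl
    by_cases h1 : x 0 = 0
    · simp [h1]
    · have := h (x 0) (x 1) h1
      rw [← hx] at this
      simp [this]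
  rcases mul_eq_zero.1 h0 with h1 | h1
  · exact hf h1
  · exact X_ne_zero _ h1

/-- Simultaneous diagonalization of a pair of symmetric matrices `M, B` such that `M` is invertible
and `M⁻¹ * B` has distinct eigenvalues. -/
theorem exists_transpose_mul_mul_eq_diagonal {K : Type*} [Field K] [IsAlgClosed K]
    {n : ℕ} {M B : Matrix (Fin n) (Fin n) K} (hM : M.IsSymm) (hB : B.IsSymm)
    (hdet : M.det ≠ 0) {d : Fin n → K} (hd : Function.Injective d)
    (hroot : ∀ i, (M⁻¹ * B).charpoly.IsRoot (d i)) :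
    ∃ P : Matrix (Fin n) (Fin n) K, Pᵀ * M * P = 1 ∧ Pᵀ * B * P = diagonal d := by
  have hMu : IsUnit M.det := isUnit_iff_ne_zero.2 hdet
  set T := M⁻¹ * B with hT
  have hMT : M * T = B := by rw [hT, Matrix.mul_nonsing_inv_cancel_left _ _ hMu]
  have hev : ∀ i, ∃ v, Module.End.HasEigenvector (Matrix.toLin' T) (d i) v := fun i => by
    have : Module.End.HasEigenvalue (Matrix.toLin' T) (d i) := by
      rw [Module.End.hasEigenvalue_iff_isRoot_charpoly, Matrix.charpoly_toLin']
      exact hroot i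
    exact this.exists_hasEigenvector
  choose v hv using hev
  have hli := Module.End.eigenvectors_linearIndependent' (Matrix.toLin' T) d hd v hv
  set P : Matrix (Fin n) (Fin n) K := (Matrix.of v)ᵀ with hP
  have hPu : IsUnit P.det := by
    rw [hP, det_transpose, ← Matrix.isUnit_iff_isUnit_det, ← Matrix.linearIndependent_rows_iff_isUnit]
    exact hli
  have hTP : T * P = P * diagonal d := by
    ext i j
    have := congrFun (hv j).apply_eq_smul i
    rw [mul_diagonal]
    simpa [hP, Matrix.mul_apply, Matrix.mulVec, dotProduct, mul_comm] using this
  set Q := Pᵀ * M * P with hQ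
  have hQs : Qᵀ = Q := by
    simp only [hQ, transpose_mul, transpose_transpose, hM.eq, Matrix.mul_assoc]
  have hBQ : Pᵀ * B * P = Q * diagonal d := by
    rw [← hMT, hQ]
    simp only [Matrix.mul_assoc, hTP]
  have hcomm : Q * diagonal d = diagonal d * Q := by
    have : (Pᵀ * B * P)ᵀ = Pᵀ * B * P := by
      simp only [transpose_mul, transpose_transpose, hB.eq, Matrix.mul_assoc]
    rw [hBQ, transpose_mul, hQs, diagonal_transpose] at this
    exact this.symm
  have hQd : Q = diagonal fun i => Q i i := by
    ext i j
    by_cases hij : i = j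
    · simp [hij]
    · have h := congrFun (congrFun hcomm i) j
      rw [mul_diagonal, diagonal_mul, mul_comm, ← sub_eq_zero, ← sub_mul] at h
      rw [diagonal_apply_ne _ hij]
      exact (mul_eq_zero.1 h).resolve_left (sub_ne_zero.2 fun h => hij (hd h.symm))
  have hQ0 : ∀ i, Q i i ≠ 0 := by
    have h : Q.det ≠ 0 := by
      rw [hQ, det_mul, det_mul, det_transpose]
      exact mul_ne_zero (mul_ne_zero hPu.ne_zero hdet) hPu.ne_zero
    rw [hQd, det_diagonal] at h
    exact fun i => Finset.prod_ne_zero_iff.1 h i (Finset.mem_univ i)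
  choose c hc using fun i => IsAlgClosed.exists_pow_nat_eq (Q i i)⁻¹ two_pos
  have hcQ : diagonal c * Q * diagonal c = 1 := by
    rw [hQd, diagonal_mul_diagonal, diagonal_mul_diagonal, ← diagonal_one]
    congr 1
    ext i
    rw [mul_right_comm, ← pow_two, hc, inv_mul_cancel₀ (hQ0 i)]
  refine ⟨P * diagonal c, ?_, ?_⟩
  · rw [← hcQ, hQ, transpose_mul, diagonal_transpose]
    simp only [Matrix.mul_assoc]
  · calc (P * diagonal c)ᵀ * B * (P * diagonal c)
        = diagonal c * (Pᵀ * B * P) * diagonal c := by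
          rw [transpose_mul, diagonal_transpose]
          simp only [Matrix.mul_assoc]
      _ = diagonal c * Q * diagonal c * diagonal d := by
          rw [hBQ]
          simp only [Matrix.mul_assoc, (commute_diagonal d c).eq]
      _ = diagonal d := by rw [hcQ, Matrix.one_mul]

/-- Two pairs that are congruent to the same pair `(1, D)`, with `D` diagonal, and whose first
members have the same determinant are congruent by a matrix of determinant one. -/
theorem exists_det_eq_one_of_transpose_mul_mul_eq_diagonal {K : Type*} [Field K] {n : ℕ}
    (hn : 0 < n) {M B M' B' P P' : Matrix (Fin n) (Fin n) K} {d : Fin n → K}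
    (hdet : M.det = M'.det)
    (hP : Pᵀ * M * P = 1) (hPB : Pᵀ * B * P = diagonal d)
    (hP' : P'ᵀ * M' * P' = 1) (hPB' : P'ᵀ * B' * P' = diagonal d) :
    ∃ g : Matrix (Fin n) (Fin n) K, g.det = 1 ∧ gᵀ * M' * g = M ∧ gᵀ * B' * g = B := by
  have h1 : P.det * M.det * P.det = 1 := by simpa using congrArg det hP
  have h1' : P'.det * M'.det * P'.det = 1 := by simpa using congrArg det hP'
  have hPu : IsUnit P.det := .of_mul_eq_one _ (by rw [← h1, mul_assoc])
  have hinv : P * P⁻¹ = 1 := mul_nonsing_inv _ hPu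
  have hinv' : (P⁻¹)ᵀ * Pᵀ = 1 := by rw [← transpose_mul, hinv, transpose_one]
  have hM0 : M.det ≠ 0 := fun h => by simp [h] at h1
  obtain ⟨e, he, hed⟩ : ∃ e : Fin n → K, (∀ i, e i * e i = 1) ∧ (∏ i, e i) * P'.det = P.det := by
    have hsq : P.det * P.det = P'.det * P'.det := by
      refine mul_right_cancel₀ hM0 ?_
      rw [mul_right_comm, h1, mul_right_comm, hdet, h1']
    rcases mul_self_eq_mul_self_iff.1 hsq with h | h
    · exact ⟨1, by simp, by simp [h]⟩
    · refine ⟨Function.update 1 ⟨0, hn⟩ (-1), fun i => ?_, ?_⟩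
      · by_cases hi : i = ⟨0, hn⟩
        · simp [hi]
        · simp [Function.update_of_ne hi]
      · rw [Finset.prod_update_of_mem (Finset.mem_univ _)]
        simp [h]
  have key : ∀ (N N' D : Matrix (Fin n) (Fin n) K), Pᵀ * N * P = D → P'ᵀ * N' * P' = D →
      diagonal e * D * diagonal e = D →
      (P' * diagonal e * P⁻¹)ᵀ * N' * (P' * diagonal e * P⁻¹) = N := by
    intro N N' D h h' hD
    calc (P' * diagonal e * P⁻¹)ᵀ * N' * (P' * diagonal e * P⁻¹)
        = (P⁻¹)ᵀ * (diagonal e * (P'ᵀ * N' * P') * diagonal e) * P⁻¹ := by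
          simp only [transpose_mul, diagonal_transpose, Matrix.mul_assoc]
      _ = ((P⁻¹)ᵀ * Pᵀ) * N * (P * P⁻¹) := by
          rw [h', hD, ← h]
          simp only [Matrix.mul_assoc]
      _ = N := by rw [hinv, hinv', Matrix.one_mul, Matrix.mul_one]
  refine ⟨P' * diagonal e * P⁻¹, ?_, key _ _ _ hP hP' ?_, key _ _ _ hPB hPB' ?_⟩
  · rw [det_mul, det_mul, det_diagonal, mul_comm P'.det, hed, ← det_mul, hinv, det_one]
  · rw [Matrix.mul_one, diagonal_mul_diagonal, funext he, diagonal_one]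
  · rw [diagonal_mul_diagonal, diagonal_mul_diagonal]
    congr 1
    ext i
    rw [mul_right_comm, he, one_mul]

/-- over an algebraically closed field of characteristic zero, two pairs of
symmetric matrices with the same squarefree invariant binary form lie in the same
`SL_n`-orbit. -/
theorem pairs_with_same_invariant_form_are_SL_equivalent
    {K : Type*} [Field K] [IsAlgClosed K] [CharZero K] (n : ℕ) (hn : 2 ≤ n)
    (f : MvPolynomial (Fin 2) K) (hsf : Squarefree f)
    (A B A' B' : Matrix (Fin n) (Fin n) K)
    (hA : A.IsSymm) (hB : B.IsSymm) (hA' : A'.IsSymm) (hB' : B'.IsSymm)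
    (hf : invBinForm n A B = f) (hf' : invBinForm n A' B' = f) :
    ∃ g : Matrix (Fin n) (Fin n) K, g.det = 1 ∧ gᵀ * A' * g = A ∧ gᵀ * B' * g = B := by
  classical
  subst hf
  obtain ⟨s, t, hs, hst⟩ := exists_eval_ne_zero_fst_ne_zero hsf.ne_zero
  have hpencil : ∀ A B : Matrix (Fin n) (Fin n) K, (s • A - t • B).det =
      (-1) ^ (n * (n - 1) / 2) * eval ![s, t] (invBinForm n A B) := fun A B => by
    simpa using det_pencil_eq_aeval_invBinForm n A B s t
  have hdet : (s • A - t • B).det = (s • A' - t • B').det := by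
    rw [hpencil, hpencil, hf']
  have h0 : (s • A - t • B).det ≠ 0 := by
    rw [hpencil]
    exact mul_ne_zero (pow_ne_zero _ (neg_ne_zero.2 one_ne_zero)) hst
  have h0' : (s • A' - t • B').det ≠ 0 := hdet ▸ h0
  have hchar : ((s • A - t • B)⁻¹ * B).charpoly = ((s • A' - t • B')⁻¹ * B').charpoly := by
    have h1 := det_mul_det_smul_one_sub_smul A B h0.isUnit (Polynomial.X : Polynomial K) 1
    have h1' := det_mul_det_smul_one_sub_smul A' B' h0'.isUnit (Polynomial.X : Polynomial K) 1
    rw [hf', ← h1, ← hdet] at h1'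
    have h2 := mul_left_cancel₀ (by simpa using h0) h1'
    simpa [Matrix.charpoly, charmatrix, smul_one_eq_diagonal] using h2.symm
  have hnodup := nodup_roots_charpoly_of_squarefree hsf hs h0.isUnit
  set p := ((s • A - t • B)⁻¹ * B).charpoly with hp
  have hcard : p.roots.toFinset.card = n := by
    rw [Multiset.toFinset_card_of_nodup hnodup,
      ← (IsAlgClosed.splits p).natDegree_eq_card_roots, hp, Matrix.charpoly_natDegree_eq_dim,
      Fintype.card_fin]
  let e := (Finset.equivFinOfCardEq hcard).symm
  let d : Fin n → K := fun i => e i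
  have hd : Function.Injective d := Subtype.val_injective.comp e.injective
  have hroot : ∀ i, p.IsRoot (d i) := fun i =>
    Polynomial.isRoot_of_mem_roots (Multiset.mem_toFinset.1 (e i).2)
  obtain ⟨P, hP, hPB⟩ := exists_transpose_mul_mul_eq_diagonal
    ((hA.smul s).sub (hB.smul t)) hB h0 hd hroot
  obtain ⟨P', hP', hPB'⟩ := exists_transpose_mul_mul_eq_diagonal
    ((hA'.smul s).sub (hB'.smul t)) hB' h0' hd (hchar ▸ hroot)
  obtain ⟨g, hg, hgM, hgB⟩ := exists_det_eq_one_of_transpose_mul_mul_eq_diagonal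
    (by lia) hdet hP hPB hP' hPB'
  refine ⟨g, hg, ?_, hgB⟩
  rw [Matrix.mul_sub, Matrix.sub_mul, Matrix.mul_smul, Matrix.mul_smul, Matrix.smul_mul,
    Matrix.smul_mul, hgB, sub_left_inj] at hgM
  exact smul_right_injective _ hs hgM
end

section
/- Let K be a field of characteristic 0, n ≥ 2, and f(x,y) = f₀xⁿ + f₁xⁿ⁻¹y + ⋯ + fₙyⁿ a binary form over K with f₀ ≠ 0 such that the polynomial f(T,1) ∈ K[T] is separable of degree n. Let L = K[T]/(f(T,1)). For every unit α ∈ L^× and every z ∈ K^× satisfying z²·N_{L/K}(α) = f₀^{n+1}, there exists a pair (A,B) of symmetric n×n matrices over K with (−1)^{n(n−1)/2}·det(A·x − B·y) = f(x,y). -/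
open MvPolynomial Matrix

/-- The binary form `f₀xⁿ + f₁xⁿ⁻¹y + ⋯ + fₙyⁿ` with coefficient tuple `f`. -/
noncomputable def binForm {R : Type*} [CommRing R] (n : ℕ) (f : Fin (n + 1) → R) :
    MvPolynomial (Fin 2) R :=
  ∑ i : Fin (n + 1), C (f i) * X 0 ^ (n - (i : ℕ)) * X 1 ^ (i : ℕ)

theorem Fin.sign_revPerm (n : ℕ) :
    Equiv.Perm.sign (Fin.revPerm : Equiv.Perm (Fin n)) = (-1) ^ (n * (n - 1) / 2) := by
  rw [Equiv.Perm.sign_eq_prod_prod_Iio]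
  have h : ∀ j : Fin n, (∏ i ∈ Finset.Iio j,
      if Fin.revPerm i < Fin.revPerm j then (1 : ℤˣ) else -1) = (-1) ^ (j : ℕ) := by
    intro j
    rw [Finset.prod_congr rfl (g := fun _ => (-1 : ℤˣ)), Finset.prod_const, Fin.card_Iio]
    intro i hi
    have hij := Finset.mem_Iio.mp hi
    rw [if_neg]
    simpa using hij.le
  rw [Finset.prod_congr rfl fun j _ => h j, Finset.prod_pow_eq_pow_sum,
    Fin.sum_univ_eq_sum_range (fun i => i) n, Finset.sum_range_id]

/-- The determinant of a matrix vanishing above the antidiagonal, with ones on it. -/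
theorem Matrix.det_of_antitriangular {R : Type*} [CommRing R] {n : ℕ}
    (M : Matrix (Fin n) (Fin n) R) (hlt : ∀ i j : Fin n, (i : ℕ) + j + 1 < n → M i j = 0)
    (heq : ∀ i j : Fin n, (i : ℕ) + j + 1 = n → M i j = 1) :
    M.det = (-1) ^ (n * (n - 1) / 2) := by
  have htri : (M.submatrix Fin.revPerm id).det = 1 := by
    rw [Matrix.det_of_isUpperTriangular]
    · refine Finset.prod_eq_one fun i _ => heq _ _ ?_
      simp only [Fin.revPerm_apply, Fin.val_rev, id]
      omega
    · intro i j hij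
      refine hlt _ _ ?_
      have : (j : ℕ) < i := hij
      simp only [Fin.revPerm_apply, Fin.val_rev, id]
      omega
  rw [Matrix.det_permute, Fin.sign_revPerm] at htri
  push_cast at htri
  have hsq : ((-1 : R) ^ (n * (n - 1) / 2)) * (-1) ^ (n * (n - 1) / 2) = 1 := by
    rw [← mul_pow]; simp
  linear_combination (-1 : R) ^ (n * (n - 1) / 2) * htri - M.det * hsq

section GramMatrix

variable {R S ι : Type*} [CommRing R] [CommRing S] [Algebra R S]

/-- The Gram matrix in the basis `b` of the symmetric bilinear form `(x, y) ↦ φ (β * x * y)`. -/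
noncomputable def twistedGram (b : Module.Basis ι R S) (φ : S →ₗ[R] R) : S →ₗ[R] Matrix ι ι R where
  toFun β := Matrix.of fun i j => φ (b i * (β * b j))
  map_add' x y := by ext; simp [add_mul, mul_add]
  map_smul' r x := by ext; simp

theorem twistedGram_apply (b : Module.Basis ι R S) (φ : S →ₗ[R] R) (β : S) (i j : ι) :
    twistedGram b φ β i j = φ (b i * (β * b j)) := rfl

theorem twistedGram_isSymm (b : Module.Basis ι R S) (φ : S →ₗ[R] R) (β : S) :
    (twistedGram b φ β).IsSymm := by
  refine Matrix.IsSymm.ext fun i j => ?_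
  rw [twistedGram_apply, twistedGram_apply, mul_left_comm, mul_left_comm (b i), mul_comm (b i)]

theorem twistedGram_eq_mul_leftMulMatrix [Fintype ι] [DecidableEq ι] (b : Module.Basis ι R S)
    (φ : S →ₗ[R] R) (β : S) :
    twistedGram b φ β = twistedGram b φ 1 * Algebra.leftMulMatrix b β := by
  ext i j
  rw [Matrix.mul_apply, twistedGram_apply]
  nth_rewrite 1 [← b.sum_repr (β * b j)]
  rw [Finset.mul_sum, map_sum]
  simp [twistedGram_apply, Algebra.leftMulMatrix_eq_repr_mul, mul_comm (φ _) (b.repr _ _)]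

theorem det_twistedGram [Fintype ι] [DecidableEq ι] (b : Module.Basis ι R S)
    (φ : S →ₗ[R] R) (β : S) :
    (twistedGram b φ β).det = (twistedGram b φ 1).det * Algebra.norm R β := by
  rw [twistedGram_eq_mul_leftMulMatrix, Matrix.det_mul, Algebra.norm_eq_matrix_det b]

/-- For `φ` the top coordinate of a power basis, the Gram matrix of `(x, y) ↦ φ (x * y)` has
determinant `(-1) ^ (n * (n - 1) / 2)`. -/
theorem PowerBasis.det_twistedGram_one (pb : PowerBasis R S) (last : Fin pb.dim)
    (hlast : (last : ℕ) + 1 = pb.dim) :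
    (twistedGram pb.basis (pb.basis.coord last) 1).det =
      (-1) ^ (pb.dim * (pb.dim - 1) / 2) := by
  have key : ∀ i j k : Fin pb.dim, (i : ℕ) + j = k →
      twistedGram pb.basis (pb.basis.coord last) 1 i j = if k = last then 1 else 0 := by
    intro i j k hk
    rw [twistedGram_apply, one_mul, pb.basis_eq_pow i, pb.basis_eq_pow j, ← pow_add, hk,
      ← pb.basis_eq_pow k, Module.Basis.coord_apply, pb.basis.repr_self, Finsupp.single_apply]
  refine Matrix.det_of_antitriangular _ (fun i j h => ?_) fun i j h => ?_
  · rw [key i j ⟨i + j, by omega⟩ rfl, if_neg]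
    rw [Fin.ext_iff]
    simp only
    omega
  · rw [key i j last (by omega), if_pos rfl]

end GramMatrix

theorem PowerBasis.norm_algebraMap_sub_smul_gen {K S : Type*} [Field K] [CommRing S] [Algebra K S]
    (pb : PowerBasis K S) (a : K) {c : K} (hc : c ≠ 0) :
    Algebra.norm K (algebraMap K S a - c • pb.gen) =
      c ^ pb.dim * (minpoly K pb.gen).eval (a / c) := by
  rw [← charpoly_leftMulMatrix, Matrix.eval_charpoly, Algebra.norm_eq_matrix_det pb.basis]
  have h : Algebra.leftMulMatrix pb.basis (algebraMap K S a - c • pb.gen) =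
      c • (Matrix.scalar _ (a / c) - Algebra.leftMulMatrix pb.basis pb.gen) := by
    rw [map_sub, map_smul, AlgHom.commutes, smul_sub, Matrix.algebraMap_eq_diagonal]
    congr 1
    ext i j
    simp [Matrix.diagonal_apply, mul_div_cancel₀ _ hc]
  rw [h, Matrix.det_smul, Fintype.card_fin]

theorem PowerBasis.norm_algebraMap {K S : Type*} [Field K] [CommRing S] [Algebra K S]
    (pb : PowerBasis K S) (a : K) : Algebra.norm K (algebraMap K S a) = a ^ pb.dim := by
  rw [Algebra.norm_algebraMap_of_basis pb.basis, Fintype.card_fin]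

theorem eval_invBinForm {R : Type*} [CommRing R] (n : ℕ) (A B : Matrix (Fin n) (Fin n) R)
    (v : Fin 2 → R) :
    eval v (invBinForm n A B) = (-1) ^ (n * (n - 1) / 2) * (v 0 • A - v 1 • B).det := by
  rw [invBinForm, map_mul, map_pow, map_neg, map_one, RingHom.map_det]
  congr 2
  ext i j
  simp [mul_comm]

theorem eval_binForm {R : Type*} [CommRing R] (n : ℕ) (f : Fin (n + 1) → R) (v : Fin 2 → R) :
    eval v (binForm n f) = ∑ i : Fin (n + 1), f i * v 0 ^ (n - (i : ℕ)) * v 1 ^ (i : ℕ) := by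
  simp [binForm]

/-- let `K` be a field of characteristic `0`, `f` a binary form of degree `n ≥ 2`
with `f₀ ≠ 0` whose dehomogenization `p = f(T,1)` is separable of degree `n`, and
`L = K[T]/(p)`. For every unit `α` of `L` and `z ∈ K^×` with `z² · N_{L/K}(α) = f₀^{n+1}`,
there is a pair of symmetric matrices whose invariant binary form is `f`. -/
theorem exists_pair_of_norm_equation
    {K : Type*} [Field K] [CharZero K] (n : ℕ) (hn : 2 ≤ n)
    (f : Fin (n + 1) → K) (hf0 : f 0 ≠ 0)
    (p : Polynomial K)
    (hp : p = ∑ i : Fin (n + 1), Polynomial.C (f i) * Polynomial.X ^ (n - (i : ℕ)))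
    (hsep : p.Separable) (hdeg : p.natDegree = n)
    (α : AdjoinRoot p) (hα : IsUnit α)
    (z : K) (hz : z ≠ 0)
    (hnorm : z ^ 2 * Algebra.norm K α = f 0 ^ (n + 1)) :
    ∃ A B : Matrix (Fin n) (Fin n) K, A.IsSymm ∧ B.IsSymm ∧
      invBinForm n A B = binForm n f := by
  have hp0 : p ≠ 0 := hsep.ne_zero
  have hlead : p.leadingCoeff = f 0 := by
    rw [Polynomial.leadingCoeff, hdeg, hp, Polynomial.finsetSum_coeff,
      Finset.sum_eq_single (0 : Fin (n + 1))]
    · simp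
    · intro i _ hi
      have : (i : ℕ) ≠ 0 := fun h => hi (Fin.ext h)
      rw [Polynomial.coeff_C_mul_X_pow, if_neg]
      omega
    · simp
  obtain ⟨pb, hgen, hdim⟩ : ∃ pb : PowerBasis K (AdjoinRoot p),
      pb.gen = AdjoinRoot.root p ∧ pb.dim = n :=
    ⟨AdjoinRoot.powerBasis hp0, AdjoinRoot.powerBasis_gen hp0, hdeg⟩
  have hmin : minpoly K pb.gen = p * Polynomial.C (f 0)⁻¹ := by
    rw [hgen, AdjoinRoot.minpoly_root hp0, hlead]
  have hform (v : Fin 2 → K) :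
      f 0 * Algebra.norm K (algebraMap K (AdjoinRoot p) (v 0) - v 1 • pb.gen) =
        eval v (binForm n f) := by
    rw [eval_binForm]
    by_cases hv : v 1 = 0
    · rw [hv, zero_smul, sub_zero, pb.norm_algebraMap, hdim,
        Finset.sum_eq_single (0 : Fin (n + 1))]
      · simp
      · intro i _ hi
        have : (i : ℕ) ≠ 0 := fun h => hi (Fin.ext h)
        simp [this]
      · simp
    · rw [pb.norm_algebraMap_sub_smul_gen _ hv, hmin, hdim, Polynomial.eval_mul,
        Polynomial.eval_C, hp, Polynomial.eval_finsetSum]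
      field_simp
      rw [Finset.mul_sum]
      refine Finset.sum_congr rfl fun i _ => ?_
      have hi : n - (i : ℕ) + i = n := Nat.sub_add_cancel (Nat.lt_succ_iff.mp i.2)
      simp only [Polynomial.eval_mul, Polynomial.eval_C, Polynomial.eval_pow, Polynomial.eval_X]
      rw [div_pow]
      nth_rewrite 1 [← hi]
      rw [pow_add]
      field_simp
  subst hdim
  have hd : 0 < pb.dim := by omega
  let last : Fin pb.dim := ⟨pb.dim - 1, by omega⟩
  let G := twistedGram pb.basis (pb.basis.coord last)
  let D : Matrix (Fin pb.dim) (Fin pb.dim) K :=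
    Matrix.diagonal (Function.update 1 ⟨0, hd⟩ z)
  have hD : D.det = z := by
    simp [D, Matrix.det_diagonal, Finset.prod_update_of_mem]
  have hsymm (β : AdjoinRoot p) : ((f 0)⁻¹ • (D * G β * D)).IsSymm := by
    have h : (G β)ᵀ = G β := twistedGram_isSymm _ _ β
    simp [Matrix.IsSymm, Matrix.transpose_mul, h, D, Matrix.mul_assoc]
  refine ⟨_, _, hsymm α, hsymm (α * pb.gen), MvPolynomial.funext fun v => ?_⟩
  have hpencil : v 0 • ((f 0)⁻¹ • (D * G α * D)) - v 1 • ((f 0)⁻¹ • (D * G (α * pb.gen) * D)) =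
      (f 0)⁻¹ • (D * G (α * (algebraMap K (AdjoinRoot p) (v 0) - v 1 • pb.gen)) * D) := by
    rw [mul_sub, mul_comm α (algebraMap _ _ _), ← Algebra.smul_def, mul_smul_comm, map_sub,
      map_smul, map_smul, Matrix.mul_sub, Matrix.sub_mul, smul_sub]
    simp only [Matrix.mul_smul, Matrix.smul_mul, smul_comm (f 0)⁻¹]
  have hG : (G 1).det = (-1) ^ (pb.dim * (pb.dim - 1) / 2) :=
    pb.det_twistedGram_one last (Nat.sub_add_cancel hd)
  have hsq : ((-1 : K) ^ (pb.dim * (pb.dim - 1) / 2)) * (-1) ^ (pb.dim * (pb.dim - 1) / 2) = 1 := by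
    rw [← mul_pow]; simp
  rw [eval_invBinForm, hpencil, Matrix.det_smul, Matrix.det_mul, Matrix.det_mul, hD,
    det_twistedGram, hG, map_mul, Fintype.card_fin, ← hform v]
  set N := Algebra.norm K (algebraMap K (AdjoinRoot p) (v 0) - v 1 • pb.gen)
  have hscale : (f 0)⁻¹ ^ pb.dim * (z ^ 2 * Algebra.norm K α) = f 0 := by
    rw [hnorm, pow_succ, ← mul_assoc, ← mul_pow, inv_mul_cancel₀ hf0, one_pow, one_mul]
  linear_combination (f 0)⁻¹ ^ pb.dim * z ^ 2 * Algebra.norm K α * N * hsq + N * hscale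
end

section
/- Let n ≥ 2 and let A, B be real symmetric n×n matrices such that the binary form det(A·x − B·y), regarded as a homogeneous polynomial of degree n over ℂ, is squarefree of degree n (i.e. has nonzero discriminant). Then there exists an invertible complex matrix P ∈ GL_n(ℂ) such that both PᵗAP and PᵗBP are diagonal matrices. -/
open MvPolynomial Matrix

/-- The binary form `det(A·x - B·y)` of a pair of real matrices, regarded as a polynomial
over `ℂ` in the variables `X 0` (for `x`) and `X 1` (for `y`). -/
noncomputable def binDetC (n : ℕ) (A B : Matrix (Fin n) (Fin n) ℝ) :
    MvPolynomial (Fin 2) ℂ :=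
  (Matrix.of fun i j => C ((A i j : ℂ)) * X 0 - C ((B i j : ℂ)) * X 1).det

/-- Evaluating the binary form `binDetC n A B` at a point gives the determinant of the
corresponding member of the pencil. -/
lemma eval_binDetC (n : ℕ) (A B : Matrix (Fin n) (Fin n) ℝ) (x : Fin 2 → ℂ) :
    eval x (binDetC n A B) =
      (x 0 • A.map ((↑) : ℝ → ℂ) - x 1 • B.map ((↑) : ℝ → ℂ)).det := by
  rw [binDetC, RingHom.map_det]
  congr 1
  ext i j
  simp [mul_comm]

/-- Over an algebraically closed field, the binary form `det (a - b M)` splits into linear factors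
indexed by the roots of the characteristic polynomial. -/
lemma det_smul_one_sub_smul_eq_prod_roots_s5 {K ι : Type*} [Field K] [IsAlgClosed K] [Fintype ι]
    [DecidableEq ι] (M : Matrix ι ι K) (a b : K) :
    (a • (1 : Matrix ι ι K) - b • M).det =
      (M.charpoly.roots.map fun r => a - b * r).prod := by
  have hs := IsAlgClosed.splits M.charpoly
  have hcard : M.charpoly.roots.card = Fintype.card ι := by
    rw [← hs.natDegree_eq_card_roots, M.charpoly_natDegree_eq_dim]
  by_cases hb : b = 0
  · simp [hb, hcard]
  have hm : a • (1 : Matrix ι ι K) - b • M = b • (Matrix.scalar ι (a / b) - M) := by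
    rw [smul_sub, Matrix.scalar_apply, ← Matrix.smul_one_eq_diagonal, smul_smul,
      mul_div_cancel₀ _ hb]
  have he := congrArg (Polynomial.eval (a / b))
    (hs.eq_prod_roots_of_monic M.charpoly_monic)
  have hprod : (M.charpoly.roots.map fun r => a - b * r).prod =
      (M.charpoly.roots.map fun r => b * (a / b - r)).prod := by
    simp_rw [mul_sub, mul_div_cancel₀ _ hb]
  rw [hm, det_smul, ← Matrix.eval_charpoly, he, Polynomial.eval_multiset_prod, hprod,
    Multiset.prod_map_mul, Multiset.map_map]
  simp [hcard]

/-- If `M` is invertible, `M` and `B` are symmetric and the characteristic polynomial of `M⁻¹ B`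
has simple roots, then `M` and `B` are simultaneously diagonalizable by congruence. -/
lemma exists_isDiag_of_nodup_roots_charpoly {K : Type*} [Field K] [IsAlgClosed K] {n : ℕ}
    {M B : Matrix (Fin n) (Fin n) K} (hM : M.IsSymm) (hB : B.IsSymm) (hdet : IsUnit M.det)
    (hroots : (M⁻¹ * B).charpoly.roots.Nodup) :
    ∃ P : Matrix (Fin n) (Fin n) K, IsUnit P.det ∧ (Pᵀ * M * P).IsDiag ∧
      (Pᵀ * B * P).IsDiag := by
  classical
  have hcard : (M⁻¹ * B).charpoly.roots.toFinset.card = n := by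
    rw [Multiset.toFinset_card_of_nodup hroots,
      ← (IsAlgClosed.splits _).natDegree_eq_card_roots, charpoly_natDegree_eq_dim,
      Fintype.card_fin]
  let e := (Finset.equivFinOfCardEq hcard).symm
  have hev (i : Fin n) : Module.End.HasEigenvalue (toLin' (M⁻¹ * B)) (e i : K) := by
    rw [Module.End.hasEigenvalue_iff_isRoot_charpoly, charpoly_toLin']
    exact Polynomial.isRoot_of_mem_roots (Multiset.mem_toFinset.mp (e i).2)
  choose v hv using fun i => (hev i).exists_hasEigenvector
  have hinj : Function.Injective fun i => (e i : K) := Subtype.val_injective.comp e.injective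
  have hli := Module.End.eigenvectors_linearIndependent' _ _ hinj v hv
  have hBv (i : Fin n) : B *ᵥ v i = (e i : K) • (M *ᵥ v i) := by
    have h := congrArg (M *ᵥ ·) (hv i).apply_eq_smul
    simpa [mulVec_mulVec, ← Matrix.mul_assoc, mul_nonsing_inv _ hdet, mulVec_smul] using h
  have entry (N : Matrix (Fin n) (Fin n) K) (i j : Fin n) :
      (of v * N * (of v)ᵀ) i j = v i ⬝ᵥ N *ᵥ v j := by
    rw [Matrix.mul_assoc]
    rfl
  have symm {N : Matrix (Fin n) (Fin n) K} (hN : N.IsSymm) (x y : Fin n → K) :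
      x ⬝ᵥ N *ᵥ y = y ⬝ᵥ N *ᵥ x := by
    rw [dotProduct_mulVec, ← mulVec_transpose, hN.eq, dotProduct_comm]
  have horth {i j : Fin n} (hij : i ≠ j) : v i ⬝ᵥ M *ᵥ v j = 0 := by
    have h := symm hB (v i) (v j)
    rw [hBv, hBv, dotProduct_smul, dotProduct_smul, symm hM (v j) (v i), smul_eq_mul,
      smul_eq_mul, ← sub_eq_zero, ← sub_mul] at h
    exact (mul_eq_zero.mp h).resolve_left (sub_ne_zero.mpr fun h => hij (hinj h).symm)
  refine ⟨(of v)ᵀ, ?_, fun i j hij => ?_, fun i j hij => ?_⟩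
  · rw [det_transpose, ← isUnit_iff_isUnit_det, ← linearIndependent_rows_iff_isUnit]
    exact hli
  · exact (entry M i j).trans (horth hij)
  · refine (entry B i j).trans ?_
    rw [hBv, dotProduct_smul, horth hij, smul_zero]

/-- a pair of real symmetric matrices whose binary form `det(A·x - B·y)` is
squarefree of degree `n` over `ℂ` can be simultaneously diagonalized by an invertible
complex matrix. -/
theorem exists_simultaneous_diagonalization
    (n : ℕ) (hn : 2 ≤ n) (A B : Matrix (Fin n) (Fin n) ℝ)
    (hA : A.IsSymm) (hB : B.IsSymm)
    (hsf : Squarefree (binDetC n A B)) (hdeg : (binDetC n A B).totalDegree = n) :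
    ∃ P : Matrix (Fin n) (Fin n) ℂ, IsUnit P.det ∧
      (Pᵀ * A.map ((↑) : ℝ → ℂ) * P).IsDiag ∧ (Pᵀ * B.map ((↑) : ℝ → ℂ) * P).IsDiag := by
  obtain ⟨z, hz⟩ : ∃ z, eval z (X 0 * binDetC n A B) ≠ 0 := by
    by_contra! h
    exact mul_ne_zero (X_ne_zero 0) hsf.ne_zero (MvPolynomial.funext fun z => by simpa using h z)
  rw [map_mul, eval_X, eval_binDetC] at hz
  have hs : z 0 ≠ 0 := left_ne_zero_of_mul hz
  set A' := A.map ((↑) : ℝ → ℂ) with hA'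
  set B' := B.map ((↑) : ℝ → ℂ) with hB'
  set M := z 0 • A' - z 1 • B' with hM
  have hdet : IsUnit M.det := (right_ne_zero_of_mul hz).isUnit
  have hAM : A' = (z 0)⁻¹ • (M + z 1 • B') := by
    rw [hM, sub_add_cancel, smul_smul, inv_mul_cancel₀ hs, one_smul]
  have hA's : A'.IsSymm := hA.map _
  have hB's : B'.IsSymm := hB.map _
  have hMs : M.IsSymm := (hA's.smul _).sub (hB's.smul _)
  let L : ℂ → MvPolynomial (Fin 2) ℂ := fun r =>
    C (z 0)⁻¹ * X 0 - (X 1 - C (z 1 * (z 0)⁻¹) * X 0) * C r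
  have hfac : binDetC n A B =
      C M.det * ((M⁻¹ * B').charpoly.roots.map L).prod := by
    refine MvPolynomial.funext fun x => ?_
    have hx : x 0 • A' - x 1 • B' = M * (((z 0)⁻¹ * x 0) • (1 : Matrix (Fin n) (Fin n) ℂ) -
        (x 1 - z 1 * (z 0)⁻¹ * x 0) • (M⁻¹ * B')) := by
      rw [mul_sub, mul_smul_comm, mul_smul_comm, mul_one, mul_nonsing_inv_cancel_left _ _ hdet,
        hAM]
      module
    rw [eval_binDetC, ← hA', ← hB', hx, det_mul, det_smul_one_sub_smul_eq_prod_roots_s5, map_mul,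
      eval_C, map_multiset_prod, Multiset.map_map]
    simp [L]
  have hroots : (M⁻¹ * B').charpoly.roots.Nodup := by
    refine Multiset.nodup_iff_ne_cons_cons.mpr fun r t ht => ?_
    have hu : IsUnit (L r) := hsf _ ⟨C M.det * (t.map L).prod, by
      rw [hfac, ht, Multiset.map_cons, Multiset.map_cons, Multiset.prod_cons,
        Multiset.prod_cons]
      ring⟩
    simpa [L] using hu.map (eval (0 : Fin 2 → ℂ))
  obtain ⟨P, hP, hPM, hPB⟩ := exists_isDiag_of_nodup_roots_charpoly hMs hB's hdet hroots
  refine ⟨P, hP, ?_, hPB⟩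
  rw [hAM, mul_smul_comm, smul_mul_assoc, mul_add, add_mul, mul_smul_comm, smul_mul_assoc]
  exact (hPM.add (hPB.smul _)).smul _
end

section
/- Let n ≥ 2 and let A, B be real symmetric n×n matrices such that the binary form det(A·x − B·y) is squarefree of degree n over ℂ. If P, Q ∈ GL_n(ℂ) both simultaneously diagonalize (A,B) (that is, PᵗAP, PᵗBP, QᵗAQ, QᵗBQ are all diagonal), then P⁻¹Q is a monomial matrix: there exist a permutation σ of {1,…,n} and nonzero complex numbers d₁,…,dₙ such that the (i,j) entry of P⁻¹Q equals dⱼ if i = σ(j) and 0 otherwise. -/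
open MvPolynomial Matrix

/-- Two members of a squarefree product of binary linear forms are never proportional. -/
theorem mul_ne_mul_of_squarefree_prod_linear {K ι : Type*} [Field K] [Fintype ι] [DecidableEq ι]
    (a b : ι → K)
    (h : Squarefree (∏ i, (C (a i) * X 0 - C (b i) * X 1) : MvPolynomial (Fin 2) K))
    {i j : ι} (hij : i ≠ j) : a i * b j ≠ a j * b i := by
  intro heq
  obtain ⟨u, v, c, d, hi, hi', hj, hj'⟩ :
      ∃ u v c d : K, a i = c * u ∧ b i = c * v ∧ a j = d * u ∧ b j = d * v := by
    by_cases ha : a i = 0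
    · by_cases hb : b i = 0
      · exact ⟨a j, b j, 0, 1, by simp [ha], by simp [hb], by simp, by simp⟩
      · refine ⟨a i, b i, 1, b j / b i, by simp, by simp, ?_, by field_simp⟩
        field_simp
        linear_combination -heq
    · refine ⟨a i, b i, 1, a j / a i, by simp, by simp, by field_simp, ?_⟩
      field_simp
      linear_combination heq
  set l : MvPolynomial (Fin 2) K := C u * X 0 - C v * X 1 with hl
  have hdvd : l * l ∣ ∏ i, (C (a i) * X 0 - C (b i) * X 1 : MvPolynomial (Fin 2) K) := by
    rw [← Finset.mul_prod_erase _ _ (Finset.mem_univ i),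
      ← Finset.mul_prod_erase _ _ (Finset.mem_erase.2 ⟨hij.symm, Finset.mem_univ j⟩), ← mul_assoc]
    refine Dvd.dvd.mul_right (mul_dvd_mul ⟨C c, ?_⟩ ⟨C d, ?_⟩) _
    · rw [hi, hi', hl, C_mul, C_mul]; ring
    · rw [hj, hj', hl, C_mul, C_mul]; ring
  simpa [hl] using (h l hdvd).map (eval (0 : Fin 2 → K))

/-- If `P` simultaneously diagonalizes the pair, the binary form is, up to the factor
`det P ^ 2`, the product of the linear forms given by the diagonal entries. -/
theorem C_det_sq_mul_binDetC {n : ℕ} {A B : Matrix (Fin n) (Fin n) ℝ}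
    {P : Matrix (Fin n) (Fin n) ℂ} {a b : Fin n → ℂ}
    (hA : Pᵀ * A.map ((↑) : ℝ → ℂ) * P = diagonal a)
    (hB : Pᵀ * B.map ((↑) : ℝ → ℂ) * P = diagonal b) :
    C (P.det ^ 2) * binDetC n A B = ∏ i, (C (a i) * X 0 - C (b i) * X 1) := by
  let c : ℂ → MvPolynomial (Fin 2) ℂ := C
  let x : MvPolynomial (Fin 2) ℂ := X 0
  let y : MvPolynomial (Fin 2) ℂ := X 1
  have hpencil : (Matrix.of fun i j => C ((A i j : ℂ)) * X 0 - C ((B i j : ℂ)) * X 1) =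
      x • (A.map ((↑) : ℝ → ℂ)).map c - y • (B.map ((↑) : ℝ → ℂ)).map c := by
    ext1 i j
    simp [c, x, y, mul_comm]
  have hcongr : (P.map c)ᵀ *
      (x • (A.map ((↑) : ℝ → ℂ)).map c - y • (B.map ((↑) : ℝ → ℂ)).map c) * P.map c =
      diagonal fun i => C (a i) * X 0 - C (b i) * X 1 := by
    rw [Matrix.mul_sub, Matrix.sub_mul, Matrix.mul_smul, Matrix.mul_smul, Matrix.smul_mul,
      Matrix.smul_mul, ← Matrix.transpose_map, ← Matrix.map_mul, ← Matrix.map_mul,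
      ← Matrix.map_mul, ← Matrix.map_mul, hA, hB, diagonal_map C_0, diagonal_map C_0,
      ← diagonal_smul, ← diagonal_smul, diagonal_sub]
    congr 1
    ext1 i
    simp [x, y, mul_comm]
  have hdet : (P.map c).det = C P.det :=
    ((C : ℂ →+* MvPolynomial (Fin 2) ℂ).map_det P).symm
  rw [← det_diagonal, ← hcongr, det_mul, det_mul, det_transpose, hdet, binDetC, hpencil, C_pow]
  ring

/-- A congruence between two pairs of diagonal matrices is monomial as soon as the diagonal
entries of the first pair are pairwise non-proportional. -/
theorem exists_perm_of_transpose_mul_diagonal_mul {K ι : Type*} [Field K] [Fintype ι]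
    [DecidableEq ι] {M : Matrix ι ι K} (hM : IsUnit M.det) {a b α β : ι → K}
    (hne : ∀ i j, i ≠ j → a i * b j ≠ a j * b i)
    (hA : Mᵀ * diagonal a * M = diagonal α) (hB : Mᵀ * diagonal b * M = diagonal β) :
    ∃ (σ : Equiv.Perm ι) (d : ι → K), (∀ j, d j ≠ 0) ∧
      ∀ i j, M i j = if i = σ j then d j else 0 := by
  have hMT : IsUnit Mᵀ.det := by rwa [det_transpose]
  have entry {c γ : ι → K} (h : Mᵀ * diagonal c * M = diagonal γ) (i j : ι) :
      c i * M i j = Mᵀ⁻¹ i j * γ j := by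
    rw [← diagonal_mul, ← mul_diagonal, ← h, Matrix.mul_assoc, nonsing_inv_mul_cancel_left _ _ hMT]
  have cross (i j : ι) (hij : M i j ≠ 0) : a i * β j = b i * α j :=
    mul_left_cancel₀ hij <| by linear_combination β j * entry hA i j - α j * entry hB i j
  have unique (i k j : ι) (hi : M i j ≠ 0) (hk : M k j ≠ 0) : i = k := by
    by_contra hik
    refine hne i k hik ?_
    by_cases hα : α j = 0
    · by_cases hβ : β j = 0
      · have ha : a i = 0 := by simpa [hα, hi] using entry hA i j
        have hb : b i = 0 := by simpa [hβ, hi] using entry hB i j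
        simp [ha, hb]
      · exact mul_left_cancel₀ hβ <| by
          linear_combination b k * cross i j hi - b i * cross k j hk
    · exact mul_left_cancel₀ hα <| by
        linear_combination a k * cross i j hi - a i * cross k j hk
  have hcol (j : ι) : ∃ i, M i j ≠ 0 := by
    by_contra! h
    exact hM.ne_zero (det_eq_zero_of_column_eq_zero j h)
  have hrow (i : ι) : ∃ j, M i j ≠ 0 := by
    by_contra! h
    exact hM.ne_zero (det_eq_zero_of_row_eq_zero i h)
  choose s hs using hcol
  have hsurj : Function.Surjective s := fun i =>
    let ⟨j, hj⟩ := hrow i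
    ⟨j, unique _ _ j (hs j) hj⟩
  refine ⟨Equiv.ofBijective s (Finite.surjective_iff_bijective.1 hsurj), fun j => M (s j) j, hs,
    fun i j => ?_⟩
  rw [Equiv.ofBijective_apply]
  split_ifs with h
  · rw [h]
  · by_contra hij
    exact h (unique _ _ j hij (hs j))

/-- any two invertible complex matrices simultaneously diagonalizing a pair of
real symmetric matrices with squarefree binary form differ by a monomial matrix, i.e.
`P⁻¹Q` has entries `dⱼ ≠ 0` at the positions `(σ(j), j)` for a permutation `σ`, and `0`
elsewhere. -/
theorem simultaneous_diagonalizers_differ_by_monomial_matrix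
    (n : ℕ) (hn : 2 ≤ n) (A B : Matrix (Fin n) (Fin n) ℝ)
    (hA : A.IsSymm) (hB : B.IsSymm)
    (hsf : Squarefree (binDetC n A B)) (hdeg : (binDetC n A B).totalDegree = n)
    (P Q : Matrix (Fin n) (Fin n) ℂ) (hP : IsUnit P.det) (hQ : IsUnit Q.det)
    (hPA : (Pᵀ * A.map ((↑) : ℝ → ℂ) * P).IsDiag) (hPB : (Pᵀ * B.map ((↑) : ℝ → ℂ) * P).IsDiag)
    (hQA : (Qᵀ * A.map ((↑) : ℝ → ℂ) * Q).IsDiag) (hQB : (Qᵀ * B.map ((↑) : ℝ → ℂ) * Q).IsDiag) :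
    ∃ (σ : Equiv.Perm (Fin n)) (d : Fin n → ℂ), (∀ j, d j ≠ 0) ∧
      ∀ i j, (P⁻¹ * Q) i j = if i = σ j then d j else 0 := by
  obtain ⟨a, hPa⟩ : ∃ a, _ = diagonal a := ⟨_, hPA.diagonal_diag.symm⟩
  obtain ⟨b, hPb⟩ : ∃ b, _ = diagonal b := ⟨_, hPB.diagonal_diag.symm⟩
  have hassoc : Associated (binDetC n A B) (C (P.det ^ 2) * binDetC n A B) :=
    associated_unit_mul_right _ _ ((hP.pow 2).map C)
  rw [C_det_sq_mul_binDetC hPa hPb] at hassoc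
  have hsf' := hassoc.squarefree_iff.1 hsf
  have hcongr (S : Matrix (Fin n) (Fin n) ℂ) :
      (P⁻¹ * Q)ᵀ * (Pᵀ * S * P) * (P⁻¹ * Q) = Qᵀ * S * Q := by
    have hPQ : P * (P⁻¹ * Q) = Q := mul_nonsing_inv_cancel_left _ _ hP
    calc _ = (P * (P⁻¹ * Q))ᵀ * S * (P * (P⁻¹ * Q)) := by
          simp only [transpose_mul, Matrix.mul_assoc]
      _ = _ := by rw [hPQ]
  have hdet : IsUnit (P⁻¹ * Q).det := by
    rw [det_mul]
    exact (isUnit_nonsing_inv_det P hP).mul hQ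
  have hMA := hcongr (A.map ((↑) : ℝ → ℂ))
  have hMB := hcongr (B.map ((↑) : ℝ → ℂ))
  rw [hPa, ← hQA.diagonal_diag] at hMA
  rw [hPb, ← hQB.diagonal_diag] at hMB
  exact exists_perm_of_transpose_mul_diagonal_mul hdet
    (fun i j => mul_ne_mul_of_squarefree_prod_linear a b hsf') hMA hMB
end

section
/- Let n ≥ 1, let 0 < c < 1 and ε > 0. Let u be a real n×n upper triangular matrix with all diagonal entries equal to 1, let t = diag(t₁,…,tₙ) with all tᵢ > 0, ∏ᵢ tᵢ = 1, and tᵢ > c·t_{i+1} for 1 ≤ i ≤ n−1. Set g = u·t and H = (g⁻¹)ᵗ·g⁻¹, so that vᵗHv = ‖g⁻¹v‖² for v ∈ ℝⁿ. If there exists a nonzero vector v ∈ ℤⁿ with vᵗHv < ε², then t₁ > c^{n−1}/ε. -/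
open Matrix

/-- If successive terms satisfy `c * t (i + 1) < t i`, then `c ^ k * t k ≤ t 0`. -/
theorem pow_mul_le_of_ratio_lt {n : ℕ} (hn : 1 ≤ n) {c : ℝ} (hc0 : 0 < c) (t : Fin n → ℝ)
    (ht_ratio : ∀ i : ℕ, (h : i + 1 < n) →
      c * t ⟨i + 1, h⟩ < t ⟨i, Nat.lt_of_succ_lt h⟩) (k : ℕ) (hk : k < n) :
    c ^ k * t ⟨k, hk⟩ ≤ t ⟨0, hn⟩ := by
  induction k with
  | zero => simp
  | succ k ih =>
    calc c ^ (k + 1) * t ⟨k + 1, hk⟩ = c ^ k * (c * t ⟨k + 1, hk⟩) := by ring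
      _ ≤ c ^ k * t ⟨k, Nat.lt_of_succ_lt hk⟩ := by
        gcongr
        exact (ht_ratio k hk).le
      _ ≤ t ⟨0, hn⟩ := ih _

/-- At the last nonzero coordinate of `w`, an upper triangular matrix acts by its
diagonal entry. -/
theorem exists_ne_zero_mulVec_eq_diag_mul {n : ℕ} (g : Matrix (Fin n) (Fin n) ℝ)
    (hg : ∀ i j : Fin n, j < i → g i j = 0) {w : Fin n → ℝ} (hw : w ≠ 0) :
    ∃ k, w k ≠ 0 ∧ (g *ᵥ w) k = g k k * w k := by
  obtain ⟨i, hi⟩ := Function.ne_iff.mp hw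
  obtain ⟨k, hk, hmax⟩ := (Finset.univ.filter fun j => w j ≠ 0).exists_max_image id
    ⟨i, by simpa using hi⟩
  refine ⟨k, by simpa using hk, ?_⟩
  rw [Matrix.mulVec_eq_sum, Finset.sum_apply]
  refine (Finset.sum_eq_single k (fun j _ hj => ?_) (by simp)).trans (by simp)
  rcases lt_or_gt_of_ne hj with h | h
  · simp [hg k j h]
  · have : w j = 0 := by
      by_contra hne
      exact (hmax j (by simpa using hne)).not_gt h
    simp [this]

/-- if an inner product on `ℝⁿ` of determinant one, written in Iwasawa
coordinates `g = u·t` (with `u` unipotent upper triangular and `t` diagonal with positive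
entries, product one, and successive ratios `tᵢ > c·tᵢ₊₁`), admits a nonzero integer vector
`v` with `vᵗHv < ε²` where `H = (g⁻¹)ᵗ·g⁻¹`, then `t₁ > c^{n−1}/ε`. -/
theorem first_iwasawa_coordinate_large_of_small_vector
    (n : ℕ) (hn : 1 ≤ n) (c ε : ℝ) (hc0 : 0 < c) (hc1 : c < 1) (hε : 0 < ε)
    (u : Matrix (Fin n) (Fin n) ℝ)
    (hu_lower : ∀ i j : Fin n, j < i → u i j = 0)
    (hu_diag : ∀ i, u i i = 1)
    (t : Fin n → ℝ) (ht_pos : ∀ i, 0 < t i) (ht_prod : ∏ i, t i = 1)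
    (ht_ratio : ∀ i : ℕ, (h : i + 1 < n) →
      c * t ⟨i + 1, h⟩ < t ⟨i, Nat.lt_of_succ_lt h⟩)
    (v : Fin n → ℤ) (hv : v ≠ 0)
    (hsmall : (fun i => (v i : ℝ)) ⬝ᵥ
        ((((u * Matrix.diagonal t)⁻¹)ᵀ * (u * Matrix.diagonal t)⁻¹) *ᵥ fun i => (v i : ℝ))
      < ε ^ 2) :
    c ^ (n - 1) / ε < t ⟨0, hn⟩ := by
  set g := u * Matrix.diagonal t with hg
  have hdet : IsUnit g.det := by
    have hu : u.det = 1 := by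
      rw [Matrix.det_of_isUpperTriangular fun i j h => hu_lower i j h]
      simp [hu_diag]
    simp [hg, hu, ht_prod]
  set x : Fin n → ℝ := fun i => (v i : ℝ) with hx
  set w := g⁻¹ *ᵥ x with hw
  have hgw : g *ᵥ w = x := by
    rw [hw, Matrix.mulVec_mulVec, Matrix.mul_nonsing_inv _ hdet, Matrix.one_mulVec]
  have hw0 : w ≠ 0 := by
    intro h
    apply hv
    funext i
    have := congrFun hgw i
    simpa [h, hx, eq_comm] using this
  obtain ⟨k, hk, hgk⟩ := exists_ne_zero_mulVec_eq_diag_mul g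
    (fun i j h => by simp [hg, Matrix.mul_diagonal, hu_lower i j h]) hw0
  have hvk : (v k : ℝ) = t k * w k := by
    rw [hgw] at hgk
    simpa [hg, Matrix.mul_diagonal, hu_diag] using hgk
  have hnorm : w ⬝ᵥ w < ε ^ 2 := by
    rwa [← Matrix.mulVec_mulVec, Matrix.mulVec_transpose, dotProduct_comm,
      ← Matrix.dotProduct_mulVec] at hsmall
  have hwk : |w k| < ε := by
    refine abs_lt_of_sq_lt_sq (lt_of_le_of_lt ?_ hnorm) hε.le
    rw [sq]
    exact Finset.single_le_sum (f := fun i => w i * w i)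
      (fun i _ => mul_self_nonneg _) (Finset.mem_univ k)
  have hone : 1 ≤ t k * |w k| := by
    have hvk0 : v k ≠ 0 := by
      have : (v k : ℝ) ≠ 0 := hvk ▸ mul_ne_zero (ht_pos k).ne' hk
      exact_mod_cast this
    rw [← abs_of_pos (ht_pos k), ← abs_mul, ← hvk]
    exact_mod_cast Int.one_le_abs hvk0
  have htk : 1 < t k * ε := hone.trans_lt (mul_lt_mul_of_pos_left hwk (ht_pos k))
  rw [div_lt_iff₀ hε]
  calc c ^ (n - 1) < c ^ (n - 1) * (t k * ε) := lt_mul_of_one_lt_right (by positivity) htk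
    _ ≤ c ^ (k : ℕ) * (t k * ε) := by
      have := ht_pos k
      exact mul_le_mul_of_nonneg_right
        (pow_le_pow_of_le_one hc0.le hc1.le (Nat.le_sub_one_of_lt k.isLt)) (by positivity)
    _ = c ^ (k : ℕ) * t k * ε := by ring
    _ ≤ t ⟨0, hn⟩ * ε := mul_le_mul_of_nonneg_right
      (pow_mul_le_of_ratio_lt hn hc0 t ht_ratio k k.isLt) hε.le
end

section
/- Let A be a Dedekind domain whose fraction field K has characteristic 0, let n ≥ 2, and let f(x,y) = f₀xⁿ + f₁xⁿ⁻¹y + ⋯ + fₙyⁿ ∈ A[x,y] be a homogeneous form of degree n with nonzero discriminant (equivalently, f is squarefree as an element of K[x,y]). If f is primitive, i.e. the ideal of A generated by its coefficients f₀,…,fₙ is the unit ideal, then the scheme S_f = Proj(A[x,y]/(f)) is affine. -/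
open AlgebraicGeometry

/-- The binary form `f₀xⁿ + ⋯ + fₙyⁿ` over a commutative ring `A`, attached to a coefficient
tuple `f : Fin (n+1) → A`, in the variables `X 0` (for `x`) and `X 1` (for `y`). -/
noncomputable def binFormA (n : ℕ) {A : Type*} [CommRing A] (f : Fin (n + 1) → A) :
    MvPolynomial (Fin 2) A :=
  ∑ i : Fin (n + 1), MvPolynomial.C (f i) *
    MvPolynomial.X 0 ^ (n - (i : ℕ)) * MvPolynomial.X 1 ^ (i : ℕ)

/-- The standard grading (by total degree) on the quotient `A[x,y]/I` of the polynomial ring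
in two variables by an ideal `I`: the `k`-th graded piece is the image of the homogeneous
degree-`k` part of `A[x,y]`. -/
noncomputable def quotGrading {A : Type*} [CommRing A] (I : Ideal (MvPolynomial (Fin 2) A)) :
    ℕ → Submodule A (MvPolynomial (Fin 2) A ⧸ I) :=
  fun k => (MvPolynomial.homogeneousSubmodule (Fin 2) A k).map
    (Ideal.Quotient.mkₐ A I).toLinearMap

/-- Over a domain, a binary form whose last nonzero coefficient has index `k` has no common zero
other than the origin with the form `u ^ (k + 1) + v * G`, where `G` is the sum of the first
`k + 1` monomials of the form divided by `u ^ (n - k)`. -/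
theorem eq_zero_and_eq_zero_of_binary_forms_eq_zero {R : Type*} [CommRing R] [IsDomain R] {n : ℕ}
    (c : Fin (n + 1) → R) (k : Fin (n + 1)) (hk : c k ≠ 0) (hlt : ∀ i, k < i → c i = 0) {u v : R}
    (hf : ∑ i, c i * u ^ (n - (i : ℕ)) * v ^ (i : ℕ) = 0)
    (hh : u ^ ((k : ℕ) + 1) +
      v * ∑ i ∈ Finset.Iic k, c i * u ^ ((k : ℕ) - i) * v ^ (i : ℕ) = 0) :
    u = 0 ∧ v = 0 := by
  set G := ∑ i ∈ Finset.Iic k, c i * u ^ ((k : ℕ) - i) * v ^ (i : ℕ) with hG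
  have hfG : u ^ (n - (k : ℕ)) * G = 0 := by
    rw [← hf, hG, Finset.mul_sum]
    rw [← Finset.sum_subset (Finset.subset_univ (Finset.Iic k))]
    · refine Finset.sum_congr rfl fun i hi ↦ ?_
      have hik : (i : ℕ) ≤ k := Fin.le_def.mp (Finset.mem_Iic.mp hi)
      have : n - (i : ℕ) = (n - k) + (k - i) := by have := k.is_lt; omega
      rw [this, pow_add]
      ring
    · intro i _ hi
      rw [hlt i (by simpa using hi)]
      ring
  have hu : u = 0 := by
    have : u ^ (n - (k : ℕ)) * u ^ ((k : ℕ) + 1) = 0 := by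
      linear_combination u ^ (n - (k : ℕ)) * hh - v * hfG
    rcases mul_eq_zero.mp this with h | h <;> exact eq_zero_of_pow_eq_zero h
  refine ⟨hu, ?_⟩
  have hGk : G = c k * v ^ (k : ℕ) := by
    rw [hG, Finset.sum_eq_single_of_mem k (Finset.mem_Iic.mpr le_rfl)]
    · simp
    · intro i hi hik
      have : (k : ℕ) - i ≠ 0 := by
        have : i < k := lt_of_le_of_ne (Finset.mem_Iic.mp hi) hik
        have : (i : ℕ) < k := this
        omega
      simp [hu, this]
  have : c k * v ^ ((k : ℕ) + 1) = 0 := by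
    rw [hGk, hu, zero_pow (Nat.succ_ne_zero _), zero_add] at hh
    rw [← hh]
    ring
  exact eq_zero_of_pow_eq_zero ((mul_eq_zero.mp this).resolve_left hk)

namespace AlgebraicGeometry.Proj

variable {σ B : Type*} [CommRing B] [SetLike σ B] [AddSubgroupClass σ B]
  (𝒜 : ℕ → σ) [GradedRing 𝒜]

/-- The preimage of `D(a)` under `Proj 𝒜 ⟶ Spec (𝒜 0)` is the basic open set of `a`. -/
theorem toSpecZero_preimage_basicOpen (a : 𝒜 0) :
    toSpecZero 𝒜 ⁻¹ᵁ PrimeSpectrum.basicOpen a = basicOpen 𝒜 (a : B) := by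
  ext x
  obtain ⟨m, f, hm, hf, hx⟩ : ∃ (m : ℕ) (f : B), 0 < m ∧ f ∈ 𝒜 m ∧ x ∈ basicOpen 𝒜 f := by
    have := x.not_irrelevant_le
    rw [HomogeneousIdeal.irrelevant_le] at this
    push Not at this
    obtain ⟨m, hm, hle⟩ := this
    obtain ⟨f, hf, hfx⟩ := SetLike.not_le_iff_exists.mp hle
    exact ⟨m, f, hm, hf, hfx⟩
  rw [← opensRange_awayι 𝒜 f hf hm] at hx
  obtain ⟨y, rfl⟩ := hx
  have hy : awayι 𝒜 f hf hm y ∈ basicOpen 𝒜 f := by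
    rw [← opensRange_awayι 𝒜 f hf hm]
    exact ⟨y, rfl⟩
  have haf : (a : B) * f ∈ 𝒜 m := by simpa using SetLike.mul_mem_graded a.2 hf
  have hpre := awayι_preimage_basicOpen 𝒜 hf hm haf hm
  have helem : HomogeneousLocalization.Away.isLocalizationElem hf haf =
      HomogeneousLocalization.fromZeroRingHom 𝒜 (.powers f) a ^ m := by
    ext
    simp only [HomogeneousLocalization.val_pow, HomogeneousLocalization.Away.val_mk]
    change _ = Localization.mk (a : B) 1 ^ m
    rw [Localization.mk_pow, Localization.mk_eq_mk_iff, Localization.r_iff_exists]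
    exact ⟨1, by simp [mul_pow, mul_comm]⟩
  rw [helem, PrimeSpectrum.basicOpen_pow _ _ hm] at hpre
  have h1 : awayι 𝒜 f hf hm y ∈ basicOpen 𝒜 (a : B) ↔
      awayι 𝒜 f hf hm y ∈ basicOpen 𝒜 ((a : B) * f) := by
    rw [basicOpen_mul]
    exact ⟨fun h ↦ ⟨h, hy⟩, fun h ↦ h.1⟩
  have h2 : awayι 𝒜 f hf hm y ∈ basicOpen 𝒜 ((a : B) * f) ↔
      y ∈ PrimeSpectrum.basicOpen (HomogeneousLocalization.fromZeroRingHom 𝒜 (.powers f) a) := by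
    rw [← hpre]; rfl
  refine Iff.trans ?_ (h1.trans h2).symm
  change toSpecZero 𝒜 (awayι 𝒜 f hf hm y) ∈ PrimeSpectrum.basicOpen a ↔ _
  rw [← Scheme.Hom.comp_apply, awayι_toSpecZero]
  rfl

/-- If every fibre of `Proj 𝒜 ⟶ Spec (𝒜 0)` is contained in the basic open set of a homogeneous
element of positive degree, then `Proj 𝒜` is affine. -/
theorem isAffine_of_forall_fiber_le_basicOpen [Algebra.FiniteType (𝒜 0) B]
    (H : ∀ q : PrimeSpectrum (𝒜 0), ∃ (m : ℕ) (h : B), 0 < m ∧ h ∈ 𝒜 m ∧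
      ∀ x : Proj 𝒜, (∀ a : 𝒜 0, (a : B) ∈ x.asHomogeneousIdeal ↔ a ∈ q.asIdeal) →
        h ∉ x.asHomogeneousIdeal) :
    IsAffine (Proj 𝒜) := by
  have : IsAffineHom (toSpecZero 𝒜) := by
    refine isAffineHom_of_forall_exists_isAffineOpen _ fun q ↦ ?_
    obtain ⟨m, h, hm, hh, hx⟩ := H q
    have hclosed := (toSpecZero 𝒜).isClosedMap _ (basicOpen 𝒜 h).isOpen.isClosed_compl
    have hq : q ∈ (toSpecZero 𝒜 '' (basicOpen 𝒜 h : Set (Proj 𝒜))ᶜ)ᶜ := by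
      rintro ⟨x, hxh, rfl⟩
      refine hxh (hx x fun a ↦ ?_)
      have : x ∈ toSpecZero 𝒜 ⁻¹ᵁ PrimeSpectrum.basicOpen a ↔ x ∈ basicOpen 𝒜 (a : B) := by
        rw [toSpecZero_preimage_basicOpen]
      exact not_iff_not.mp this.symm
    obtain ⟨_, ⟨a, rfl⟩, hqa, hle⟩ :=
      PrimeSpectrum.isTopologicalBasis_basic_opens.exists_subset_of_mem_open hq hclosed.isOpen_compl
    refine ⟨PrimeSpectrum.basicOpen a, hqa, IsAffineOpen.Spec_basicOpen a, ?_⟩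
    have hsub : basicOpen 𝒜 (a : B) ≤ basicOpen 𝒜 h := by
      intro x hxa
      rw [← toSpecZero_preimage_basicOpen] at hxa
      by_contra hxh
      exact hle hxa ⟨x, hxh, rfl⟩
    have heq : toSpecZero 𝒜 ⁻¹ᵁ PrimeSpectrum.basicOpen a = basicOpen 𝒜 ((a : B) * h) := by
      rw [toSpecZero_preimage_basicOpen, basicOpen_mul, inf_eq_left.mpr hsub]
    rw [heq]
    exact isAffineOpen_basicOpen 𝒜 _ (m := m) (by simpa using SetLike.mul_mem_graded a.2 hh) hm
  exact isAffine_of_isAffineHom (toSpecZero 𝒜)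

end AlgebraicGeometry.Proj

theorem mk_mem_quotGrading {A : Type*} [CommRing A] (I : Ideal (MvPolynomial (Fin 2) A)) {k : ℕ}
    {g : MvPolynomial (Fin 2) A} (hg : g.IsHomogeneous k) :
    Ideal.Quotient.mk I g ∈ quotGrading I k :=
  ⟨g, hg, rfl⟩

/-- A homogeneous ideal of `A[x,y]/I` containing the classes of `x` and `y` contains the
irrelevant ideal. -/
theorem irrelevant_le_of_mk_X_mem {A : Type*} [CommRing A] (I : Ideal (MvPolynomial (Fin 2) A))
    [GradedAlgebra (quotGrading I)] (P : HomogeneousIdeal (quotGrading I))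
    (hP : ∀ j, Ideal.Quotient.mk I (MvPolynomial.X j) ∈ P) :
    HomogeneousIdeal.irrelevant (quotGrading I) ≤ P := by
  rw [HomogeneousIdeal.irrelevant_le]
  rintro k hk _ ⟨g, hg, rfl⟩
  have hg : g.IsHomogeneous k := hg
  change Ideal.Quotient.mk I g ∈ P.toIdeal
  rw [g.as_sum, map_sum]
  refine Ideal.sum_mem _ fun d hd ↦ ?_
  have hd0 : d ≠ 0 := by
    rintro rfl
    have := hg (MvPolynomial.mem_support_iff.mp hd)
    simp at this
    omega
  obtain ⟨j, hj⟩ := Finsupp.ne_iff.mp hd0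
  obtain ⟨r, hr⟩ : MvPolynomial.X j ∣ MvPolynomial.monomial d (g.coeff d) := by
    rw [MvPolynomial.X_dvd_monomial]
    exact Or.inr hj
  rw [hr, map_mul]
  exact Ideal.mul_mem_right _ _ (hP j)

/-- If the coefficients of the binary form `f` generate the unit ideal of `A` and `I` contains `f`,
then `Proj (A[x,y]/I)` is affine. -/
theorem isAffine_proj_quotGrading {A : Type*} [CommRing A] (n : ℕ) (f : Fin (n + 1) → A)
    (hprim : Ideal.span (Set.range f) = (⊤ : Ideal A)) (I : Ideal (MvPolynomial (Fin 2) A))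
    (hfI : binFormA n f ∈ I) [GradedAlgebra (quotGrading I)] :
    IsAffine (Proj (quotGrading I)) := by
  have : IsScalarTower A (quotGrading I 0) (MvPolynomial (Fin 2) A ⧸ I) :=
    .of_algebraMap_eq (R := A) (S := quotGrading I 0) (A := MvPolynomial (Fin 2) A ⧸ I)
      fun _ ↦ rfl
  have : Algebra.FiniteType (quotGrading I 0) (MvPolynomial (Fin 2) A ⧸ I) :=
    .of_restrictScalars_finiteType A _ _
  refine Proj.isAffine_of_forall_fiber_le_basicOpen _ fun q ↦ ?_
  let p : Ideal A := q.asIdeal.comap (algebraMap A (quotGrading I 0))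
  have hp : p.IsPrime := inferInstance
  classical
  obtain ⟨k, hk, hkmax⟩ : ∃ k, f k ∉ p ∧ ∀ i, k < i → f i ∈ p := by
    have hne : (Finset.univ.filter fun i ↦ f i ∉ p).Nonempty := by
      by_contra hempty
      refine hp.ne_top (top_le_iff.mp (hprim ▸ Ideal.span_le.mpr ?_))
      rintro _ ⟨i, rfl⟩
      by_contra hi
      exact hempty ⟨i, by simpa using hi⟩
    refine ⟨_, (Finset.mem_filter.mp (Finset.max'_mem _ hne)).2, fun i hi ↦ ?_⟩
    by_contra hfi
    exact absurd (Finset.le_max' _ i (by simpa using hfi)) (not_le.mpr hi)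
  let h : MvPolynomial (Fin 2) A := MvPolynomial.X 0 ^ ((k : ℕ) + 1) +
    MvPolynomial.X 1 * ∑ i ∈ Finset.Iic k,
      MvPolynomial.C (f i) * MvPolynomial.X 0 ^ ((k : ℕ) - i) * MvPolynomial.X 1 ^ (i : ℕ)
  have hhom : h.IsHomogeneous ((k : ℕ) + 1) := by
    refine (MvPolynomial.isHomogeneous_X_pow _ _).add ?_
    rw [add_comm (k : ℕ)]
    refine (MvPolynomial.isHomogeneous_X _ _).mul (MvPolynomial.IsHomogeneous.sum _ _ _ ?_)
    intro i hi
    have hik : (i : ℕ) ≤ k := Fin.le_def.mp (Finset.mem_Iic.mp hi)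
    have := ((MvPolynomial.isHomogeneous_C (Fin 2) (f i)).mul
      (MvPolynomial.isHomogeneous_X_pow (R := A) (0 : Fin 2) ((k : ℕ) - i))).mul
      (MvPolynomial.isHomogeneous_X_pow (R := A) (1 : Fin 2) (i : ℕ))
    rwa [zero_add, Nat.sub_add_cancel hik] at this
  refine ⟨(k : ℕ) + 1, Ideal.Quotient.mk I h, Nat.succ_pos _, mk_mem_quotGrading I hhom,
    fun x hx hmem ↦ ?_⟩
  let P := x.asHomogeneousIdeal.toIdeal
  have : P.IsPrime := x.isPrime
  let φ : MvPolynomial (Fin 2) A →+* (MvPolynomial (Fin 2) A ⧸ I) ⧸ P :=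
    (Ideal.Quotient.mk P).comp (Ideal.Quotient.mk I)
  have hφ (g) : φ g = 0 ↔ Ideal.Quotient.mk I g ∈ x.asHomogeneousIdeal :=
    Ideal.Quotient.eq_zero_iff_mem
  have hφC (a : A) : φ (MvPolynomial.C a) = 0 ↔ a ∈ p :=
    (hφ _).trans (hx (algebraMap A (quotGrading I 0) a))
  have hφf : φ (binFormA n f) = 0 := by
    rw [RingHom.comp_apply, Ideal.Quotient.eq_zero_iff_mem.mpr hfI,
      map_zero]
  have hφh : φ h = 0 := (hφ h).mpr hmem
  simp only [binFormA, map_sum, map_mul, map_pow] at hφf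
  simp only [h, map_add, map_sum, map_mul, map_pow] at hφh
  obtain ⟨hu, hv⟩ := eq_zero_and_eq_zero_of_binary_forms_eq_zero
    (fun i ↦ φ (MvPolynomial.C (f i))) k (mt (hφC _).mp hk) (fun i hi ↦ (hφC _).mpr (hkmax i hi))
    hφf hφh
  refine x.not_irrelevant_le (irrelevant_le_of_mk_X_mem I _ fun j ↦ ?_)
  fin_cases j
  · exact (hφ _).mp hu
  · exact (hφ _).mp hv

/-- for a Dedekind domain `A` with fraction field of characteristic zero and a
primitive binary form `f` of degree `n ≥ 2` with nonzero discriminant (i.e. squarefree over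
the fraction field), the scheme `S_f = Proj (A[x,y]/(f))` is affine. -/
theorem proj_of_primitive_form_isAffine
    {A : Type*} [CommRing A] [IsDedekindDomain A] [CharZero (FractionRing A)]
    (n : ℕ) (hn : 2 ≤ n) (f : Fin (n + 1) → A)
    (hsf : Squarefree
      (MvPolynomial.map (algebraMap A (FractionRing A)) (binFormA n f)))
    (hprim : Ideal.span (Set.range f) = (⊤ : Ideal A))
    [inst : GradedAlgebra (quotGrading (Ideal.span {binFormA n f}))] :
    IsAffine (Proj (quotGrading (Ideal.span {binFormA n f}))) := by
  exact isAffine_proj_quotGrading n f hprim _ (Ideal.mem_span_singleton_self _)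
end
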